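/- arXiv:2603.17020 — 8 statements merged into one kernel-verified Lean document; each statement's English description precedes it below -/
import Mathlib

section
/- Let λ = (λ₀,λ₁,λ₂,λ₃,λ₄) ∈ ℤ⁵ and consider the quadratic form Q(λ) = λᵀ I₀ λ, which equals −2(λ₀² + λ₁²+λ₂²+λ₃²+λ₄² − λ₀(λ₁+λ₂+λ₃+λ₄)). Then Q(λ) = −2 if and only if one of the following holds: (1) there is k ∈ ℤ with λ₁ = λ₂ = λ₃ = λ₄ = k and λ₀ ∈ {2k−1, 2k+1}; (2) there are k ∈ ℤ, an index i ∈ {1,2,3,4} and ε ∈ {−1,1} with λᵢ = k+ε, λⱼ = k for all j ∈ {1,2,3,4} ∖ {i}, and λ₀ ∈ {2k, 2k+ε}; (3) there are k ∈ ℤ, distinct indices i,j ∈ {1,2,3,4} and ε ∈ {−1,1} with λᵢ = λⱼ = k+ε, λₗ = k for the remaining two indices ℓ, and λ₀ = 2k+ε. -/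
open Matrix

/-- The intersection form of the affine `D₄` Dynkin diagram. -/
def I0 : Matrix (Fin 5) (Fin 5) ℤ :=
  !![-2, 1, 1, 1, 1;
      1, -2, 0, 0, 0;
      1, 0, -2, 0, 0;
      1, 0, 0, -2, 0;
      1, 0, 0, 0, -2]

theorem dotProduct_I0_mulVec_self (l : Fin 5 → ℤ) :
    l ⬝ᵥ I0.mulVec l =
      -2 * (l 0 ^ 2 + l 1 ^ 2 + l 2 ^ 2 + l 3 ^ 2 + l 4 ^ 2
        - l 0 * (l 1 + l 2 + l 3 + l 4)) := by
  simp [I0, dotProduct, mulVec, Fin.sum_univ_five]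
  ring

/-- Completing squares: `Q(λ) = -2` means that the numbers `2λᵢ - λ₀` have square sum `4`. -/
theorem dotProduct_I0_mulVec_self_eq_neg_two_iff (l : Fin 5 → ℤ) :
    l ⬝ᵥ I0.mulVec l = -2 ↔
      (2 * l 1 - l 0) ^ 2 + (2 * l 2 - l 0) ^ 2 + (2 * l 3 - l 0) ^ 2
        + (2 * l 4 - l 0) ^ 2 = 4 := by
  rw [dotProduct_I0_mulVec_self]
  constructor <;> intro h <;> linarith

theorem bool_pattern (c : Fin 5 → Bool) :
    (∃ b, ∀ j, j ≠ 0 → c j = b) ∨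
    (∃ b i, i ≠ 0 ∧ c i = b ∧ ∀ j, j ≠ 0 → j ≠ i → c j = !b) ∨
    (∃ i j, i ≠ 0 ∧ j ≠ 0 ∧ i ≠ j ∧ c i = true ∧ c j = true ∧
      ∀ t, t ≠ 0 → t ≠ i → t ≠ j → c t = false) := by
  revert c
  decide

theorem exists_of_even (l : Fin 5 → ℤ) (m : ℤ) (h0 : l 0 = 2 * m)
    (h : (2 * l 1 - l 0) ^ 2 + (2 * l 2 - l 0) ^ 2 + (2 * l 3 - l 0) ^ 2
      + (2 * l 4 - l 0) ^ 2 = 4) :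
    ∃ i : Fin 5, i ≠ 0 ∧ ∃ ε : ℤ, (ε = -1 ∨ ε = 1) ∧ l i = m + ε ∧
      ∀ j : Fin 5, j ≠ 0 → j ≠ i → l j = m := by
  have hsum : ∑ i : Fin 4, (l i.succ - m) ^ 2 = 1 := by
    simp only [Fin.sum_univ_four, Fin.succ_zero_eq_one, Fin.succ_one_eq_two, Fin.reduceSucc]
    rw [h0] at h
    linarith
  obtain ⟨i, -, hi⟩ := Finset.exists_ne_zero_of_sum_ne_zero (hsum.trans_ne one_ne_zero)
  have hpos : 0 < (l i.succ - m) ^ 2 := lt_of_le_of_ne (sq_nonneg _) hi.symm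
  have hsplit := Finset.add_sum_erase Finset.univ (fun i : Fin 4 => (l i.succ - m) ^ 2)
    (Finset.mem_univ i)
  have hrest : 0 ≤ ∑ j ∈ Finset.univ.erase i, (l j.succ - m) ^ 2 :=
    Finset.sum_nonneg fun _ _ => sq_nonneg _
  simp only [hsum] at hsplit
  refine ⟨i.succ, Fin.succ_ne_zero i, l i.succ - m, ?_, by ring, fun j hj hji => ?_⟩
  · exact (sq_eq_sq_iff_eq_or_eq_neg.1 (show _ = (1 : ℤ) ^ 2 by linarith)).symm
  · obtain ⟨j, rfl⟩ := Fin.exists_succ_eq.2 hj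
    have hzero := (Finset.sum_eq_zero_iff_of_nonneg fun _ _ => sq_nonneg _).1
      (show ∑ j ∈ Finset.univ.erase i, (l j.succ - m) ^ 2 = 0 by linarith) j
      (Finset.mem_erase.2 ⟨fun e => hji (congrArg Fin.succ e), Finset.mem_univ j⟩)
    exact sub_eq_zero.1 (pow_eq_zero_iff two_ne_zero |>.1 hzero)

theorem eq_or_eq_of_odd (l : Fin 5 → ℤ) (m : ℤ) (h0 : l 0 = 2 * m + 1)
    (h : (2 * l 1 - l 0) ^ 2 + (2 * l 2 - l 0) ^ 2 + (2 * l 3 - l 0) ^ 2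
      + (2 * l 4 - l 0) ^ 2 = 4) (i : Fin 5) (hi : i ≠ 0) :
    l i = m ∨ l i = m + 1 := by
  have hle : (2 * l i - l 0) ^ 2 ≤ 4 := by
    have h1 := sq_nonneg (2 * l 1 - l 0)
    have h2 := sq_nonneg (2 * l 2 - l 0)
    have h3 := sq_nonneg (2 * l 3 - l 0)
    have h4 := sq_nonneg (2 * l 4 - l 0)
    fin_cases i
    · exact absurd rfl hi
    all_goals simp only [Fin.mk_one, Fin.reduceFinMk]; linarith
  obtain ⟨hl, hu⟩ := abs_le.1
    (abs_le_of_sq_le_sq (show (2 * l i - l 0) ^ 2 ≤ 2 ^ 2 by linarith) two_pos.le)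
  omega

/-- The integer vectors `λ ∈ ℤ⁵` with `λᵀ I₀ λ = -2` are exactly those of the three listed
shapes.  (The first conjunct records the identity
`λᵀ I₀ λ = -2(λ₀² + λ₁² + λ₂² + λ₃² + λ₄² - λ₀(λ₁+λ₂+λ₃+λ₄))`.) -/
theorem stmt0 (l : Fin 5 → ℤ) :
    (l ⬝ᵥ I0.mulVec l =
      -2 * (l 0 ^ 2 + l 1 ^ 2 + l 2 ^ 2 + l 3 ^ 2 + l 4 ^ 2
        - l 0 * (l 1 + l 2 + l 3 + l 4))) ∧
    (l ⬝ᵥ I0.mulVec l = -2 ↔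
      ((∃ k : ℤ, (l 1 = k ∧ l 2 = k ∧ l 3 = k ∧ l 4 = k) ∧
          (l 0 = 2 * k - 1 ∨ l 0 = 2 * k + 1)) ∨
       (∃ k : ℤ, ∃ i : Fin 5, i ≠ 0 ∧ ∃ ε : ℤ, (ε = -1 ∨ ε = 1) ∧
          l i = k + ε ∧ (∀ j : Fin 5, j ≠ 0 → j ≠ i → l j = k) ∧
          (l 0 = 2 * k ∨ l 0 = 2 * k + ε)) ∨
       (∃ k : ℤ, ∃ i j : Fin 5, i ≠ 0 ∧ j ≠ 0 ∧ i ≠ j ∧ ∃ ε : ℤ, (ε = -1 ∨ ε = 1) ∧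
          l i = k + ε ∧ l j = k + ε ∧
          (∀ t : Fin 5, t ≠ 0 → t ≠ i → t ≠ j → l t = k) ∧
          l 0 = 2 * k + ε))) := by
  refine ⟨dotProduct_I0_mulVec_self l, ?_⟩
  rw [dotProduct_I0_mulVec_self_eq_neg_two_iff]
  constructor
  · intro h
    obtain ⟨m, h0 | h0⟩ := Int.even_or_odd' (l 0)
    · obtain ⟨i, hi, ε, hε, hli, hl⟩ := exists_of_even l m h0 h
      exact .inr (.inl ⟨m, i, hi, ε, hε, hli, hl, .inl h0⟩)
    have hodd := eq_or_eq_of_odd l m h0 h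
    have htrue {i : Fin 5} (hc : decide (l i = m + 1) = true) : l i = m + 1 :=
      of_decide_eq_true hc
    have hfalse {i : Fin 5} (hi : i ≠ 0) (hc : decide (l i = m + 1) = false) : l i = m :=
      (hodd i hi).resolve_right (of_decide_eq_false hc)
    obtain ⟨b, hb⟩ | ⟨b, i, hi, hbi, hb⟩ | ⟨i, j, hi, hj, hij, hci, hcj, hc⟩ :=
      bool_pattern fun i => decide (l i = m + 1)
    · left
      cases b
      · exact ⟨m, by refine ⟨?_, ?_, ?_, ?_⟩ <;> exact hfalse (by decide) (hb _ (by decide)),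
          .inr h0⟩
      · exact ⟨m + 1, by refine ⟨?_, ?_, ?_, ?_⟩ <;> exact htrue (hb _ (by decide)),
          .inl (by linarith)⟩
    · right; left
      cases b
      · exact ⟨m + 1, i, hi, -1, .inl rfl, by linarith [hfalse hi hbi],
          fun j hj hji => htrue (hb j hj hji), .inr (by linarith)⟩
      · exact ⟨m, i, hi, 1, .inr rfl, htrue hbi,
          fun j hj hji => hfalse hj (hb j hj hji), .inr h0⟩
    · right; right
      exact ⟨m, i, j, hi, hj, hij, 1, .inr rfl, htrue hci, htrue hcj,
        fun t ht hti htj => hfalse ht (hc t ht hti htj), h0⟩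
  · rintro (⟨k, ⟨h1, h2, h3, h4⟩, h0⟩ | ⟨k, i, hi, ε, hε, hli, hl, h0⟩ |
      ⟨k, i, j, hi, hj, hij, ε, hε, hli, hlj, hl, h0⟩)
    · rw [h1, h2, h3, h4]
      rcases h0 with h0 | h0 <;> rw [h0] <;> ring
    · have hε2 : ε ^ 2 = 1 := by rcases hε with rfl | rfl <;> rfl
      have hval (j : Fin 5) (hj : j ≠ 0) : l j = if j = i then k + ε else k := by
        split_ifs with hji
        · rw [hji, hli]
        · exact hl j hj hji
      rw [hval 1 (by decide), hval 2 (by decide), hval 3 (by decide), hval 4 (by decide)]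
      fin_cases i
      · exact absurd rfl hi
      all_goals
        rcases h0 with h0 | h0 <;> rw [h0] <;> simp <;> ring_nf <;> rw [hε2] <;> rfl
    · have hε2 : ε ^ 2 = 1 := by rcases hε with rfl | rfl <;> rfl
      have hval (t : Fin 5) (ht : t ≠ 0) : (2 * l t - l 0) ^ 2 = 1 := by
        have hlt : l t = k + ε ∨ l t = k := by
          by_cases hti : t = i
          · exact .inl (hti ▸ hli)
          by_cases htj : t = j
          · exact .inl (htj ▸ hlj)
          exact .inr (hl t ht hti htj)
        rw [h0, ← hε2]
        rcases hlt with hlt | hlt <;> rw [hlt] <;> ring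
      rw [hval 1 (by decide), hval 2 (by decide), hval 3 (by decide), hval 4 (by decide)]
      rfl
end

section
/- For every A ∈ O(ℤ⁵,I₀)⁺ and every λ ∈ ℤ⁵, the map φ_A sends H_λ bijectively onto H_{A⁻¹λ}: φ_A(H_λ) = H_{A⁻¹λ}. -/
open Matrix Real

noncomputable section

/-- The generator of the kernel of `I₀`. -/
def vD4 : Fin 5 → ℤ := ![2, 1, 1, 1, 1]

/-- `A ∈ O(ℤ⁵, I₀)⁺`: an integer matrix, invertible over `ℤ`, preserving `I₀` and fixing
`v = (2,1,1,1,1)`. -/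
def OPlus (A : Matrix (Fin 5) (Fin 5) ℤ) : Prop :=
  IsUnit A ∧ Aᵀ * I0 * A = I0 ∧ A.mulVec vD4 = vD4

/-- For `λ ∈ ℤ⁵`, the codimension-three subspace
`H_λ = {((x₁,…,x₄),(z₁,…,z₄)) : Σᵢ (λ₀ - 2λᵢ) xᵢ = 4π² λ₀ ∧ Σᵢ (λ₀ - 2λᵢ) zᵢ = 0}`
of `ℝ⁴ × ℂ⁴`. -/
def Hset (l : Fin 5 → ℤ) : Set ((Fin 4 → ℝ) × (Fin 4 → ℂ)) :=
  {p | (∑ i : Fin 4, ((l 0 : ℝ) - 2 * (l i.succ : ℝ)) * p.1 i) = 4 * π ^ 2 * (l 0 : ℝ) ∧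
       (∑ i : Fin 4, ((l 0 : ℂ) - 2 * (l i.succ : ℂ)) * p.2 i) = 0}

/-- The affine transformation `φ_A` of `ℝ⁴ × ℂ⁴` associated to `A = (a_{ij})`:
`x′_j = Σᵢ (a_{ij} - a_{0j}/2) xᵢ + 2π² a_{0j}` and `z′_j = Σᵢ (a_{ij} - a_{0j}/2) zᵢ`. -/
def phiA (A : Matrix (Fin 5) (Fin 5) ℤ) :
    (Fin 4 → ℝ) × (Fin 4 → ℂ) → (Fin 4 → ℝ) × (Fin 4 → ℂ) :=
  fun p =>
    (fun j => (∑ i : Fin 4, ((A i.succ j.succ : ℝ) - (A 0 j.succ : ℝ) / 2) * p.1 i)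
        + 2 * π ^ 2 * (A 0 j.succ : ℝ),
     fun j => ∑ i : Fin 4, ((A i.succ j.succ : ℂ) - (A 0 j.succ : ℂ) / 2) * p.2 i)

section PeriodLift

variable {K : Type*} [Field K]

/-- The vector `(y₀, x₁, …, x₄)` whose pairing with `v = (2,1,1,1,1)` equals `c`. -/
def periodLift (c : K) (x : Fin 4 → K) : Fin 5 → K :=
  Fin.cons ((c - ∑ i, x i) / 2) x

/-- The affine action of `A` on the last four coordinates of `periodLift c x`. -/
def affineAct (A : Matrix (Fin 5) (Fin 5) ℤ) (c : K) (x : Fin 4 → K) : Fin 4 → K :=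
  fun j => (∑ i : Fin 4, ((A i.succ j.succ : K) - (A 0 j.succ : K) / 2) * x i)
    + c / 2 * (A 0 j.succ : K)

theorem periodLift_injective (c : K) : Function.Injective (periodLift c) := fun _ _ h =>
  (Fin.cons_injective2 h).2

theorem mem_hyperplane_iff_periodLift [CharZero K] (c : K) (x : Fin 4 → K) (l : Fin 5 → ℤ) :
    (∑ i : Fin 4, ((l 0 : K) - 2 * (l i.succ : K)) * x i) = c * (l 0 : K) ↔
      periodLift c x ⬝ᵥ (fun i => (l i : K)) = 0 := by
  have key : (∑ i : Fin 4, ((l 0 : K) - 2 * (l i.succ : K)) * x i) - c * (l 0 : K) =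
      -2 * (periodLift c x ⬝ᵥ (fun i => (l i : K))) := by
    simp only [periodLift, dotProduct, Fin.sum_univ_succ (n := 4), Fin.cons_zero, Fin.cons_succ,
      Fin.sum_univ_four]
    ring
  rw [← sub_eq_zero, key]
  simp

theorem periodLift_dotProduct_vD4 [CharZero K] (c : K) (x : Fin 4 → K) :
    periodLift c x ⬝ᵥ (fun i => (vD4 i : K)) = c := by
  simp [periodLift, dotProduct, Fin.sum_univ_succ, vD4]

theorem periodLift_tail_of_dotProduct [CharZero K] {c : K} {y : Fin 5 → K}
    (hy : y ⬝ᵥ (fun i => (vD4 i : K)) = c) : periodLift c (Fin.tail y) = y := by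
  have h0 : (c - ∑ i, Fin.tail y i) / 2 = y 0 := by
    subst hy
    simp [dotProduct, Fin.sum_univ_succ, vD4, Fin.tail]
  rw [periodLift, h0, Fin.cons_self_tail]

theorem map_intCast_mulVec_apply (A : Matrix (Fin 5) (Fin 5) ℤ) (l : Fin 5 → ℤ) :
    (fun i => ((A.mulVec l i : ℤ) : K)) =
      (A.map (Int.cast : ℤ → K)).mulVec (fun i => (l i : K)) := by
  ext i
  simp [Matrix.mulVec, dotProduct]

theorem affineAct_eq_tail (A : Matrix (Fin 5) (Fin 5) ℤ) (c : K) (x : Fin 4 → K) :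
    affineAct A c x = Fin.tail (periodLift c x ᵥ* A.map (Int.cast : ℤ → K)) := by
  ext j
  simp only [affineAct, periodLift, Fin.tail, Matrix.vecMul, dotProduct, Matrix.map_apply,
    Fin.sum_univ_succ (n := 4), Fin.cons_zero, Fin.cons_succ, Fin.sum_univ_four]
  ring

theorem periodLift_affineAct [CharZero K] {A : Matrix (Fin 5) (Fin 5) ℤ} (hA : A.mulVec vD4 = vD4)
    (c : K) (x : Fin 4 → K) :
    periodLift c (affineAct A c x) = periodLift c x ᵥ* A.map (Int.cast : ℤ → K) := by
  rw [affineAct_eq_tail]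
  apply periodLift_tail_of_dotProduct
  rw [← Matrix.dotProduct_mulVec, ← map_intCast_mulVec_apply, hA, periodLift_dotProduct_vD4]

theorem map_intCast_mul_eq_one {A B : Matrix (Fin 5) (Fin 5) ℤ} (hAB : A * B = 1) :
    A.map (Int.cast : ℤ → K) * B.map (Int.cast : ℤ → K) = 1 := by
  have h := congrArg (fun M => M.map (Int.castRingHom K)) hAB
  simp only [Matrix.map_mul, Matrix.map_one _ (map_zero _) (map_one _)] at h
  exact h

theorem affineAct_affineAct [CharZero K] {A B : Matrix (Fin 5) (Fin 5) ℤ}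
    (hA : A.mulVec vD4 = vD4) (hB : B.mulVec vD4 = vD4) (hAB : A * B = 1) (c : K) (x : Fin 4 → K) :
    affineAct B c (affineAct A c x) = x := by
  apply periodLift_injective c
  rw [periodLift_affineAct hB, periodLift_affineAct hA, Matrix.vecMul_vecMul,
    map_intCast_mul_eq_one hAB, Matrix.vecMul_one]

theorem periodLift_affineAct_dotProduct_mulVec [CharZero K] {A B : Matrix (Fin 5) (Fin 5) ℤ}
    (hA : A.mulVec vD4 = vD4) (hAB : A * B = 1) (l : Fin 5 → ℤ) (c : K) (x : Fin 4 → K) :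
    periodLift c (affineAct A c x) ⬝ᵥ (fun i => ((B.mulVec l i : ℤ) : K)) =
      periodLift c x ⬝ᵥ (fun i => (l i : K)) := by
  rw [periodLift_affineAct hA, map_intCast_mulVec_apply, Matrix.dotProduct_mulVec,
    Matrix.vecMul_vecMul, map_intCast_mul_eq_one hAB, Matrix.vecMul_one]

end PeriodLift

theorem phiA_eq_affineAct (A : Matrix (Fin 5) (Fin 5) ℤ) (p : (Fin 4 → ℝ) × (Fin 4 → ℂ)) :
    phiA A p = (affineAct A (4 * π ^ 2) p.1, affineAct A 0 p.2) := by
  ext j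
  · simp only [phiA, affineAct]
    ring
  · simp [phiA, affineAct]

theorem mem_Hset_iff_periodLift (l : Fin 5 → ℤ) (p : (Fin 4 → ℝ) × (Fin 4 → ℂ)) :
    p ∈ Hset l ↔ periodLift (4 * π ^ 2) p.1 ⬝ᵥ (fun i => (l i : ℝ)) = 0 ∧
      periodLift 0 p.2 ⬝ᵥ (fun i => (l i : ℂ)) = 0 := by
  rw [← mem_hyperplane_iff_periodLift, ← mem_hyperplane_iff_periodLift, zero_mul]
  rfl

theorem phiA_mapsTo {A B : Matrix (Fin 5) (Fin 5) ℤ} (hA : A.mulVec vD4 = vD4)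
    (hAB : A * B = 1) (l : Fin 5 → ℤ) :
    Set.MapsTo (phiA A) (Hset l) (Hset (B.mulVec l)) := by
  intro p hp
  rw [mem_Hset_iff_periodLift] at hp ⊢
  simpa only [phiA_eq_affineAct, periodLift_affineAct_dotProduct_mulVec hA hAB] using hp

theorem phiA_leftInverse {A B : Matrix (Fin 5) (Fin 5) ℤ} (hA : A.mulVec vD4 = vD4)
    (hB : B.mulVec vD4 = vD4) (hAB : A * B = 1) :
    Function.LeftInverse (phiA B) (phiA A) := fun p => by
  simp only [phiA_eq_affineAct, affineAct_affineAct hA hB hAB]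

/-- For `A ∈ O(ℤ⁵,I₀)⁺` with integer inverse `B = A⁻¹`, the map `φ_A` sends `H_λ`
bijectively onto `H_{A⁻¹ λ}`. -/
theorem stmt3 (A B : Matrix (Fin 5) (Fin 5) ℤ) (hA : OPlus A)
    (hAB : A * B = 1) (hBA : B * A = 1) (l : Fin 5 → ℤ) :
    phiA A '' Hset l = Hset (B.mulVec l) ∧
      Set.BijOn (phiA A) (Hset l) (Hset (B.mulVec l)) := by
  have hv := hA.2.2
  have hw : B.mulVec vD4 = vD4 := by
    conv_lhs => rw [← hv]
    rw [Matrix.mulVec_mulVec, hBA, Matrix.one_mulVec]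
  have hback : Set.MapsTo (phiA B) (Hset (B.mulVec l)) (Hset l) := by
    have h := phiA_mapsTo hw hBA (B.mulVec l)
    rwa [Matrix.mulVec_mulVec, hAB, Matrix.one_mulVec] at h
  have hbij : Set.BijOn (phiA A) (Hset l) (Hset (B.mulVec l)) :=
    Set.InvOn.bijOn ⟨fun p _ => phiA_leftInverse hv hw hAB p,
      fun p _ => phiA_leftInverse hw hv hBA p⟩ (phiA_mapsTo hv hAB l) hback
  exact ⟨hbij.image_eq, hbij⟩
end
end

section
/- The union of the sets H_λ over all λ ∈ ℤ⁵ with λᵀ I₀ λ = −2 equals the union over all k ∈ ℤ of the following sets: ℋ_k = {(x,z) ∈ ℝ⁴×ℂ⁴ : x₁+x₂+x₃+x₄ = (2k+1)·4π² and z₁+z₂+z₃+z₄ = 0}; ℋ_{k,i₀} = {(x,z) : x_{i₀} = 4π²·k and z_{i₀} = 0} for i₀ ∈ {1,…,4}; ℋ′_{k,i₀} = {(x,z) : 2x_{i₀} − (x₁+x₂+x₃+x₄) = (2k+1)·4π² and 2z_{i₀} − (z₁+z₂+z₃+z₄) = 0} for i₀ ∈ {1,…,4}; and ℋ_{k,i₁,i₂}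 = {(x,z) : 2(x_{i₁}+x_{i₂}) − (x₁+x₂+x₃+x₄) = (2k+1)·4π² and 2(z_{i₁}+z_{i₂}) − (z₁+z₂+z₃+z₄) = 0} for distinct i₁,i₂ ∈ {1,…,4}. -/
open Matrix Real

noncomputable section

/-- `ℋ_k`. -/
def Hk (k : ℤ) : Set ((Fin 4 → ℝ) × (Fin 4 → ℂ)) :=
  {p | (∑ i : Fin 4, p.1 i) = (2 * (k : ℝ) + 1) * (4 * π ^ 2) ∧ (∑ i : Fin 4, p.2 i) = 0}

/-- `ℋ_{k,i₀}`. -/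
def Hki (k : ℤ) (i0 : Fin 4) : Set ((Fin 4 → ℝ) × (Fin 4 → ℂ)) :=
  {p | p.1 i0 = 4 * π ^ 2 * (k : ℝ) ∧ p.2 i0 = 0}

/-- `ℋ′_{k,i₀}`. -/
def Hki' (k : ℤ) (i0 : Fin 4) : Set ((Fin 4 → ℝ) × (Fin 4 → ℂ)) :=
  {p | 2 * p.1 i0 - (∑ i : Fin 4, p.1 i) = (2 * (k : ℝ) + 1) * (4 * π ^ 2) ∧
       2 * p.2 i0 - (∑ i : Fin 4, p.2 i) = 0}

/-- `ℋ_{k,i₁,i₂}`. -/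
def Hkij (k : ℤ) (i1 i2 : Fin 4) : Set ((Fin 4 → ℝ) × (Fin 4 → ℂ)) :=
  {p | 2 * (p.1 i1 + p.1 i2) - (∑ i : Fin 4, p.1 i) = (2 * (k : ℝ) + 1) * (4 * π ^ 2) ∧
       2 * (p.2 i1 + p.2 i2) - (∑ i : Fin 4, p.2 i) = 0}

/-- The intersection form is `-1/2` times the sum of the squares of the coefficients
`l 0 - 2 * l i`. -/
theorem dotProduct_I0_mulVec_eq_neg_two_iff (l : Fin 5 → ℤ) :
    l ⬝ᵥ I0.mulVec l = -2 ↔ ∑ i : Fin 4, (l 0 - 2 * l i.succ) ^ 2 = 4 := by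
  have h : 2 * (l ⬝ᵥ I0.mulVec l) = -∑ i : Fin 4, (l 0 - 2 * l i.succ) ^ 2 := by
    simp [I0, dotProduct, mulVec, Fin.sum_univ_five, Fin.sum_univ_four]
    ring
  omega

theorem mem_Hset_iff (l : Fin 5 → ℤ) (p : (Fin 4 → ℝ) × (Fin 4 → ℂ)) :
    p ∈ Hset l ↔
      ((l 0 : ℝ) - 2 * l 1) * p.1 0 + ((l 0 : ℝ) - 2 * l 2) * p.1 1 +
        ((l 0 : ℝ) - 2 * l 3) * p.1 2 + ((l 0 : ℝ) - 2 * l 4) * p.1 3 = 4 * π ^ 2 * (l 0 : ℝ) ∧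
      ((l 0 : ℂ) - 2 * l 1) * p.2 0 + ((l 0 : ℂ) - 2 * l 2) * p.2 1 +
        ((l 0 : ℂ) - 2 * l 3) * p.2 2 + ((l 0 : ℂ) - 2 * l 4) * p.2 3 = 0 := by
  simp only [Hset, Set.mem_ofPred_eq, Fin.sum_univ_four]
  rfl

theorem exists_mem_Hki_of_even {l : Fin 5 → ℤ} {k : ℤ} (hl : l ⬝ᵥ I0.mulVec l = -2)
    (hk : l 0 = 2 * k) {p : (Fin 4 → ℝ) × (Fin 4 → ℂ)} (hp : p ∈ Hset l) :
    ∃ (m : ℤ) (i : Fin 4), p ∈ Hki m i := by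
  rw [dotProduct_I0_mulVec_eq_neg_two_iff, Fin.sum_univ_four] at hl
  simp only [Fin.isValue, Fin.reduceSucc] at hl
  obtain ⟨hx, hz⟩ := (mem_Hset_iff l p).1 hp
  obtain ⟨a, ha⟩ : ∃ a, l 1 = k - a := ⟨k - l 1, by ring⟩
  obtain ⟨b, hb⟩ : ∃ b, l 2 = k - b := ⟨k - l 2, by ring⟩
  obtain ⟨c, hc⟩ : ∃ c, l 3 = k - c := ⟨k - l 3, by ring⟩
  obtain ⟨d, hd⟩ : ∃ d, l 4 = k - d := ⟨k - l 4, by ring⟩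
  rw [hk, ha, hb, hc, hd] at hl hx hz
  have hs : a ^ 2 + b ^ 2 + c ^ 2 + d ^ 2 = 1 := by linarith
  have key : ∀ (s : ℤ) (i : Fin 4), s ^ 2 = 1 → (s : ℝ) * p.1 i = 4 * π ^ 2 * k →
      (s : ℂ) * p.2 i = 0 → ∃ (m : ℤ) (i : Fin 4), p ∈ Hki m i := by
    intro s i hs hxi hzi
    have hsr : (s : ℝ) ^ 2 = 1 := by exact_mod_cast hs
    have hsc : (s : ℂ) ^ 2 = 1 := by exact_mod_cast hs
    refine ⟨s * k, i, ?_, ?_⟩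
    · push_cast
      linear_combination (s : ℝ) * hxi - p.1 i * hsr
    · linear_combination (s : ℂ) * hzi - p.2 i * hsc
  push_cast at hx hz
  have zero_of_sq : ∀ t : ℤ, t ^ 2 ≤ 0 → t = 0 := fun t ht =>
    (pow_eq_zero_iff two_ne_zero).1 (le_antisymm ht (sq_nonneg t))
  by_cases ha0 : a = 0
  · by_cases hb0 : b = 0
    · by_cases hc0 : c = 0
      · subst ha0 hb0 hc0
        push_cast at hx hz
        exact key d 3 (by linarith) (by linear_combination hx / 2) (by linear_combination hz / 2)
      · have := sq_pos_of_ne_zero hc0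
        have hd0 := zero_of_sq d (by nlinarith)
        subst ha0 hb0 hd0
        push_cast at hx hz
        exact key c 2 (by linarith) (by linear_combination hx / 2) (by linear_combination hz / 2)
    · have := sq_pos_of_ne_zero hb0
      have hc0 := zero_of_sq c (by nlinarith)
      have hd0 := zero_of_sq d (by nlinarith)
      subst ha0 hc0 hd0
      push_cast at hx hz
      exact key b 1 (by linarith) (by linear_combination hx / 2) (by linear_combination hz / 2)
  · have := sq_pos_of_ne_zero ha0
    have hb0 := zero_of_sq b (by nlinarith)
    have hc0 := zero_of_sq c (by nlinarith)
    have hd0 := zero_of_sq d (by nlinarith)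
    subst hb0 hc0 hd0
    push_cast at hx hz
    exact key a 0 (by linarith) (by linear_combination hx / 2) (by linear_combination hz / 2)

theorem exists_mem_of_odd {l : Fin 5 → ℤ} {k : ℤ} (hl : l ⬝ᵥ I0.mulVec l = -2)
    (hk : l 0 = 2 * k + 1) {p : (Fin 4 → ℝ) × (Fin 4 → ℂ)} (hp : p ∈ Hset l) :
    ∃ m : ℤ, p ∈ Hk m ∨ (∃ i, p ∈ Hki' m i) ∨ ∃ i j, i ≠ j ∧ p ∈ Hkij m i j := by
  rw [dotProduct_I0_mulVec_eq_neg_two_iff, Fin.sum_univ_four] at hl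
  simp only [Fin.isValue, Fin.reduceSucc] at hl
  obtain ⟨hx, hz⟩ := (mem_Hset_iff l p).1 hp
  obtain ⟨a, ha⟩ : ∃ a, l 1 = k + a := ⟨l 1 - k, by ring⟩
  obtain ⟨b, hb⟩ : ∃ b, l 2 = k + b := ⟨l 2 - k, by ring⟩
  obtain ⟨c, hc⟩ : ∃ c, l 3 = k + c := ⟨l 3 - k, by ring⟩
  obtain ⟨d, hd⟩ : ∃ d, l 4 = k + d := ⟨l 4 - k, by ring⟩
  rw [hk, ha, hb, hc, hd] at hl hx hz
  have nonneg : ∀ t : ℤ, 0 ≤ t * (t - 1) := fun t => by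
    rcases le_or_gt t 0 with h | h <;> nlinarith
  have zero_or_one : ∀ t : ℤ, t * (t - 1) ≤ 0 → t = 0 ∨ t = 1 := fun t ht => by
    rcases mul_eq_zero.1 (le_antisymm ht (nonneg t)) with h | h <;> omega
  have na := nonneg a
  have nb := nonneg b
  have nc := nonneg c
  have nd := nonneg d
  have ha' := zero_or_one a (by nlinarith)
  have hb' := zero_or_one b (by nlinarith)
  have hc' := zero_or_one c (by nlinarith)
  have hd' := zero_or_one d (by nlinarith)
  clear na nb nc nd hl ha hb hc hd
  have neg (i : Fin 4)
      (hxi : (∑ j, p.1 j) - 2 * p.1 i = 4 * π ^ 2 * (2 * k + 1))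
      (hzi : (∑ j, p.2 j) - 2 * p.2 i = 0) : p ∈ Hki' (-k - 1) i := by
    refine ⟨?_, by linear_combination -hzi⟩
    push_cast
    linear_combination -hxi
  have pos (i : Fin 4)
      (hxi : 2 * p.1 i - (∑ j, p.1 j) = 4 * π ^ 2 * (2 * k + 1))
      (hzi : 2 * p.2 i - (∑ j, p.2 j) = 0) : p ∈ Hki' k i :=
    ⟨by linear_combination hxi, hzi⟩
  have pair (i j : Fin 4)
      (hxi : 2 * (p.1 i + p.1 j) - (∑ m, p.1 m) = 4 * π ^ 2 * (2 * k + 1))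
      (hzi : 2 * (p.2 i + p.2 j) - (∑ m, p.2 m) = 0) : p ∈ Hkij k i j :=
    ⟨by linear_combination hxi, hzi⟩
  simp only [Fin.sum_univ_four] at neg pos pair
  rcases ha' with rfl | rfl <;> rcases hb' with rfl | rfl <;> rcases hc' with rfl | rfl <;>
    rcases hd' with rfl | rfl <;> push_cast at hx hz
  · exact ⟨k, .inl ⟨by rw [Fin.sum_univ_four]; linear_combination hx,
      by rw [Fin.sum_univ_four]; linear_combination hz⟩⟩
  · exact ⟨-k - 1, .inr (.inl ⟨3, neg 3 (by linear_combination hx) (by linear_combination hz)⟩)⟩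
  · exact ⟨-k - 1, .inr (.inl ⟨2, neg 2 (by linear_combination hx) (by linear_combination hz)⟩)⟩
  · exact ⟨k, .inr (.inr ⟨0, 1, by decide,
      pair 0 1 (by linear_combination hx) (by linear_combination hz)⟩)⟩
  · exact ⟨-k - 1, .inr (.inl ⟨1, neg 1 (by linear_combination hx) (by linear_combination hz)⟩)⟩
  · exact ⟨k, .inr (.inr ⟨0, 2, by decide,
      pair 0 2 (by linear_combination hx) (by linear_combination hz)⟩)⟩
  · exact ⟨k, .inr (.inr ⟨0, 3, by decide,
      pair 0 3 (by linear_combination hx) (by linear_combination hz)⟩)⟩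
  · exact ⟨k, .inr (.inl ⟨0, pos 0 (by linear_combination hx) (by linear_combination hz)⟩)⟩
  · exact ⟨-k - 1, .inr (.inl ⟨0, neg 0 (by linear_combination hx) (by linear_combination hz)⟩)⟩
  · exact ⟨k, .inr (.inr ⟨1, 2, by decide,
      pair 1 2 (by linear_combination hx) (by linear_combination hz)⟩)⟩
  · exact ⟨k, .inr (.inr ⟨1, 3, by decide,
      pair 1 3 (by linear_combination hx) (by linear_combination hz)⟩)⟩
  · exact ⟨k, .inr (.inl ⟨1, pos 1 (by linear_combination hx) (by linear_combination hz)⟩)⟩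
  · exact ⟨k, .inr (.inr ⟨2, 3, by decide,
      pair 2 3 (by linear_combination hx) (by linear_combination hz)⟩)⟩
  · exact ⟨k, .inr (.inl ⟨2, pos 2 (by linear_combination hx) (by linear_combination hz)⟩)⟩
  · exact ⟨k, .inr (.inl ⟨3, pos 3 (by linear_combination hx) (by linear_combination hz)⟩)⟩
  · exact ⟨-k - 1, .inl ⟨by rw [Fin.sum_univ_four]; push_cast; linear_combination -hx,
      by rw [Fin.sum_univ_four]; linear_combination -hz⟩⟩

theorem exists_Hset_of_mem_Hk {k : ℤ} {p : (Fin 4 → ℝ) × (Fin 4 → ℂ)} (hp : p ∈ Hk k) :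
    ∃ l : Fin 5 → ℤ, l ⬝ᵥ I0.mulVec l = -2 ∧ p ∈ Hset l := by
  obtain ⟨hx, hz⟩ := hp
  rw [Fin.sum_univ_four] at hx hz
  refine ⟨![2 * k + 1, k, k, k, k], ?_, ?_⟩
  · rw [dotProduct_I0_mulVec_eq_neg_two_iff]
    simp [Fin.sum_univ_four]
  · rw [mem_Hset_iff]
    simp
    exact ⟨by linear_combination hx, by linear_combination hz⟩

theorem exists_Hset_of_mem_Hki {k : ℤ} {i : Fin 4} {p : (Fin 4 → ℝ) × (Fin 4 → ℂ)}
    (hp : p ∈ Hki k i) : ∃ l : Fin 5 → ℤ, l ⬝ᵥ I0.mulVec l = -2 ∧ p ∈ Hset l := by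
  obtain ⟨hx, hz⟩ := hp
  refine ⟨Fin.cons (2 * k) (Pi.single i (-1) + fun _ => k), ?_, ?_, ?_⟩
  · rw [dotProduct_I0_mulVec_eq_neg_two_iff]
    fin_cases i <;> simp [Fin.sum_univ_four, Pi.single_apply] <;> ring
  · fin_cases i <;> simp [Fin.sum_univ_four, Pi.single_apply] at hx ⊢ <;>
      linear_combination 2 * hx
  · fin_cases i <;> simp [Fin.sum_univ_four, Pi.single_apply] at hz ⊢ <;>
      exact .inr hz

theorem exists_Hset_of_mem_Hki' {k : ℤ} {i : Fin 4} {p : (Fin 4 → ℝ) × (Fin 4 → ℂ)}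
    (hp : p ∈ Hki' k i) : ∃ l : Fin 5 → ℤ, l ⬝ᵥ I0.mulVec l = -2 ∧ p ∈ Hset l := by
  obtain ⟨hx, hz⟩ := hp
  refine ⟨Fin.cons (2 * k + 1) (fun j => if j = i then k else k + 1), ?_, ?_, ?_⟩
  · rw [dotProduct_I0_mulVec_eq_neg_two_iff]
    fin_cases i <;> simp [Fin.sum_univ_four] <;> ring
  · fin_cases i <;> simp [Fin.sum_univ_four] at hx ⊢ <;> linear_combination hx
  · fin_cases i <;> simp [Fin.sum_univ_four] at hz ⊢ <;> linear_combination hz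

theorem exists_Hset_of_mem_Hkij {k : ℤ} {i j : Fin 4} (hij : i ≠ j)
    {p : (Fin 4 → ℝ) × (Fin 4 → ℂ)} (hp : p ∈ Hkij k i j) :
    ∃ l : Fin 5 → ℤ, l ⬝ᵥ I0.mulVec l = -2 ∧ p ∈ Hset l := by
  obtain ⟨hx, hz⟩ := hp
  refine ⟨Fin.cons (2 * k + 1) (fun m => if m = i ∨ m = j then k else k + 1), ?_, ?_, ?_⟩
  · rw [dotProduct_I0_mulVec_eq_neg_two_iff]
    fin_cases i <;> fin_cases j <;> simp [Fin.sum_univ_four] at hij ⊢ <;> ring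
  · fin_cases i <;> fin_cases j <;> simp [Fin.sum_univ_four] at hij hx ⊢ <;>
      linear_combination hx
  · fin_cases i <;> fin_cases j <;> simp [Fin.sum_univ_four] at hij hz ⊢ <;>
      linear_combination hz

/-- The union of the `H_λ` over all `λ` of self-intersection `-2` equals the explicit
arrangement of codimension-three planes. -/
theorem stmt5 :
    (⋃ (l : Fin 5 → ℤ) (_ : l ⬝ᵥ I0.mulVec l = -2), Hset l) =
    ⋃ (k : ℤ),
      (Hk k ∪ (⋃ i0 : Fin 4, Hki k i0) ∪ (⋃ i0 : Fin 4, Hki' k i0) ∪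
        ⋃ (i1 : Fin 4) (i2 : Fin 4) (_ : i1 ≠ i2), Hkij k i1 i2) := by
  ext p
  simp only [Set.mem_iUnion, Set.mem_union, exists_prop]
  constructor
  · rintro ⟨l, hl, hp⟩
    rcases Int.even_or_odd' (l 0) with ⟨k, hk | hk⟩
    · obtain ⟨m, hm⟩ := exists_mem_Hki_of_even hl hk hp
      exact ⟨m, .inl (.inl (.inr hm))⟩
    · obtain ⟨m, hm | hm | hm⟩ := exists_mem_of_odd hl hk hp
      · exact ⟨m, .inl (.inl (.inl hm))⟩
      · exact ⟨m, .inl (.inr hm)⟩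
      · exact ⟨m, .inr hm⟩
  · rintro ⟨k, ((hp | ⟨i, hp⟩) | ⟨i, hp⟩) | ⟨i, j, hij, hp⟩⟩
    · exact exists_Hset_of_mem_Hk hp
    · exact exists_Hset_of_mem_Hki hp
    · exact exists_Hset_of_mem_Hki' hp
    · exact exists_Hset_of_mem_Hkij hij hp
end
end

section
/- For every i ∈ {0,1,2,3,4}, the period maps intertwine the domain and target reflections: T ∘ rᵢ = Rᵢ ∘ T as maps ℝ⁴ → ℝ⁴, and T_ℂ ∘ rᵢ′ = Rᵢ′ ∘ T_ℂ as maps ℂ⁴ → ℂ⁴. Equivalently, the extended Torelli map 𝒯(α,m) = (T(α), T_ℂ(m)) satisfies 𝒯 ∘ (rᵢ × rᵢ′) = (Rᵢ × Rᵢ′) ∘ 𝒯 on ℝ⁴ × ℂ⁴. -/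
open Real

noncomputable section

/-- The real period map `T(α) = 4π²·(1−α₁−α₂−α₃−α₄, α₁+α₂−α₃−α₄, α₁−α₂+α₃−α₄, α₁−α₂−α₃+α₄)`. -/
def Tmap (a : Fin 4 → ℝ) : Fin 4 → ℝ :=
  ![4 * π ^ 2 * (1 - a 0 - a 1 - a 2 - a 3),
    4 * π ^ 2 * (a 0 + a 1 - a 2 - a 3),
    4 * π ^ 2 * (a 0 - a 1 + a 2 - a 3),
    4 * π ^ 2 * (a 0 - a 1 - a 2 + a 3)]

/-- The complex period map
`T_ℂ(m) = 2π·(−m₁−m₂−m₃−m₄, m₁+m₂−m₃−m₄, m₁−m₂+m₃−m₄, m₁−m₂−m₃+m₄)`. -/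
def TCmap (m : Fin 4 → ℂ) : Fin 4 → ℂ :=
  ![2 * (π : ℂ) * (-m 0 - m 1 - m 2 - m 3),
    2 * (π : ℂ) * (m 0 + m 1 - m 2 - m 3),
    2 * (π : ℂ) * (m 0 - m 1 + m 2 - m 3),
    2 * (π : ℂ) * (m 0 - m 1 - m 2 + m 3)]

/-- The normal directions of the five domain reflections `r₀,…,r₄`. -/
def coefVec : Fin 5 → (Fin 4 → ℝ) :=
  ![![-1, 1, 1, 1], ![1, 1, 1, 1], ![1, 1, -1, -1], ![1, -1, 1, -1], ![1, -1, -1, 1]]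

/-- The affine constants of the five domain reflections `r₀,…,r₄`. -/
def coefC : Fin 5 → ℝ := ![0, -1, 0, 0, 0]

/-- The domain reflections `r₀,…,r₄` of `ℝ⁴`. -/
def rr (i : Fin 5) (a : Fin 4 → ℝ) : Fin 4 → ℝ :=
  fun j => a j - ((∑ t : Fin 4, coefVec i t * a t) + coefC i) / 2 * coefVec i j

/-- The `ℂ`-linear maps `r₀′,…,r₄′` (the linear parts of the `rᵢ`, extended `ℂ`-linearly). -/
def rrC (i : Fin 5) (m : Fin 4 → ℂ) : Fin 4 → ℂ :=
  fun j => m j - (∑ t : Fin 4, (coefVec i t : ℂ) * m t) / 2 * (coefVec i j : ℂ)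

/-- The target reflections `R₀,…,R₄` of `ℝ⁴`. -/
def RRr : Fin 5 → (Fin 4 → ℝ) → (Fin 4 → ℝ) :=
  Fin.cons (fun x j => x j - ((∑ t : Fin 4, x t) - 4 * π ^ 2) / 2)
    (fun i x j => x j - 2 * x i * (if j = i then 1 else 0))

/-- The `ℂ`-linear target maps `R₀′,…,R₄′`. -/
def RRc : Fin 5 → (Fin 4 → ℂ) → (Fin 4 → ℂ) :=
  Fin.cons (fun z j => z j - (∑ t : Fin 4, z t) / 2)
    (fun i z j => z j - 2 * z i * (if j = i then 1 else 0))

/-- The real period map intertwines the reflections `rᵢ` and `Rᵢ`. -/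
theorem Tmap_rr (i : Fin 5) (a : Fin 4 → ℝ) : Tmap (rr i a) = RRr i (Tmap a) := by
  ext j
  cases i using Fin.cases with
  | zero =>
    rw [RRr, Fin.cons_zero]
    fin_cases j <;> simp [Tmap, rr, coefVec, coefC, Fin.sum_univ_four] <;> ring
  | succ i =>
    rw [RRr, Fin.cons_succ]
    fin_cases i <;> fin_cases j <;>
      simp [Tmap, rr, coefVec, coefC, Fin.sum_univ_four] <;> ring

/-- The complex period map intertwines the linear maps `rᵢ′` and `Rᵢ′`. -/
theorem TCmap_rrC (i : Fin 5) (m : Fin 4 → ℂ) : TCmap (rrC i m) = RRc i (TCmap m) := by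
  ext j
  cases i using Fin.cases with
  | zero =>
    rw [RRc, Fin.cons_zero]
    fin_cases j <;> simp [TCmap, rrC, coefVec, Fin.sum_univ_four] <;> ring
  | succ i =>
    rw [RRc, Fin.cons_succ]
    fin_cases i <;> fin_cases j <;>
      simp [TCmap, rrC, coefVec, Fin.sum_univ_four] <;> ring

/-- The period maps intertwine the domain and target reflections:
`T ∘ rᵢ = Rᵢ ∘ T`, `T_ℂ ∘ rᵢ′ = Rᵢ′ ∘ T_ℂ`, and equivalently the extended Torelli map
`𝒯(α,m) = (T(α), T_ℂ(m))` satisfies `𝒯 ∘ (rᵢ × rᵢ′) = (Rᵢ × Rᵢ′) ∘ 𝒯`. -/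
theorem stmt10 (i : Fin 5) :
    Tmap ∘ rr i = RRr i ∘ Tmap ∧
    TCmap ∘ rrC i = RRc i ∘ TCmap ∧
    (∀ (a : Fin 4 → ℝ) (m : Fin 4 → ℂ),
      (Tmap (rr i a), TCmap (rrC i m)) = (RRr i (Tmap a), RRc i (TCmap m))) := by
  exact ⟨funext (Tmap_rr i), funext (TCmap_rrC i), fun a m => Prod.ext (Tmap_rr i a) (TCmap_rrC i m)⟩
end
end

section
/- The extended Torelli map 𝒯 maps R̃^full bijectively onto the period domain 𝒫: 𝒯(R̃^full) = 𝒫. -/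
open Real

noncomputable section

/-- The extended Torelli map `𝒯(α,m) = (T(α), T_ℂ(m))`. -/
def Torelli (p : (Fin 4 → ℝ) × (Fin 4 → ℂ)) : (Fin 4 → ℝ) × (Fin 4 → ℂ) :=
  (Tmap p.1, TCmap p.2)

/-- `H_{d,e}` for `d ∈ ℤ` and `e ∈ {0,1}⁴` (encoded by booleans, `true ↔ eᵢ = 1`):
`d + Σᵢ (eᵢ + (−1)^{eᵢ} αᵢ) = 0` and `Σᵢ (−1)^{eᵢ} mᵢ = 0`. -/
def Hde (d : ℤ) (e : Fin 4 → Bool) : Set ((Fin 4 → ℝ) × (Fin 4 → ℂ)) :=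
  {p | (d : ℝ) + ∑ i : Fin 4,
        ((if e i then (1 : ℝ) else 0) + (if e i then (-1 : ℝ) else 1) * p.1 i) = 0 ∧
       ∑ i : Fin 4, (if e i then (-1 : ℂ) else 1) * p.2 i = 0}

/-- `H_{d,i}` for `d ∈ ℤ` and `i ∈ {1,…,4}`: `2αᵢ = d` and `mᵢ = 0`. -/
def Hdi (d : ℤ) (i : Fin 4) : Set ((Fin 4 → ℝ) × (Fin 4 → ℂ)) :=
  {p | 2 * p.1 i = (d : ℝ) ∧ p.2 i = 0}

/-- `R̃^full`: the complement of the arrangement of the `H_{d,e}` and `H_{d,i}`. -/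
def Rfull : Set ((Fin 4 → ℝ) × (Fin 4 → ℂ)) :=
  Set.univ \ ((⋃ (d : ℤ) (e : Fin 4 → Bool), Hde d e) ∪ ⋃ (d : ℤ) (i : Fin 4), Hdi d i)

/-- The period domain `𝒫`: the complement of the arrangement of the `ℋ`-planes. -/
def Pdom : Set ((Fin 4 → ℝ) × (Fin 4 → ℂ)) :=
  Set.univ \ ⋃ (k : ℤ),
    (Hk k ∪ (⋃ i0 : Fin 4, (Hki k i0 ∪ Hki' k i0)) ∪
      ⋃ (i1 : Fin 4) (i2 : Fin 4) (_ : i1 ≠ i2), Hkij k i1 i2)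

theorem eq_iff_eq_of_sub_eq_mul_sub {K : Type*} [Field K] {c x y u v : K} (hc : c ≠ 0)
    (h : x - y = c * (u - v)) : x = y ↔ u = v := by
  rw [← sub_eq_zero, h, mul_eq_zero, sub_eq_zero, or_iff_right hc]

theorem four_mul_pi_sq_ne_zero : 4 * π ^ 2 ≠ 0 := by positivity

theorem two_mul_pi_complex_ne_zero : 2 * (π : ℂ) ≠ 0 := by
  simp [pi_ne_zero]

theorem Hde_not (d : ℤ) (e : Fin 4 → Bool) : Hde (-d - 4) (fun i => !e i) = Hde d e := by
  ext p
  simp only [Hde, Set.mem_ofPred_eq]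
  refine and_congr (eq_iff_eq_of_sub_eq_mul_sub (c := -1) (by norm_num) ?_)
    (eq_iff_eq_of_sub_eq_mul_sub (c := -1) (by norm_num) ?_)
  · have (i : Fin 4) : (if !e i then (1 : ℝ) else 0) + (if !e i then (-1 : ℝ) else 1) * p.1 i =
        1 - ((if e i then (1 : ℝ) else 0) + (if e i then (-1 : ℝ) else 1) * p.1 i) := by
      cases e i
      · simp
        ring
      · simp
    simp only [this, Finset.sum_sub_distrib]
    simp
    ring
  · have (i : Fin 4) : (if !e i then (-1 : ℂ) else 1) * p.2 i =
        -((if e i then (-1 : ℂ) else 1) * p.2 i) := by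
      cases e i <;> simp
    simp only [this, Finset.sum_neg_distrib]
    ring

theorem Hkij_comm (k : ℤ) (i j : Fin 4) : Hkij k i j = Hkij k j i := by
  simp only [Hkij, add_comm]

theorem Torelli_mem_Hki_zero (k : ℤ) (p : (Fin 4 → ℝ) × (Fin 4 → ℂ)) :
    Torelli p ∈ Hki k 0 ↔ p ∈ Hde (k - 1) ![false, false, false, false] := by
  simp only [Torelli, Tmap, TCmap, Hki, Hde, Fin.sum_univ_four, Set.mem_ofPred_eq]
  refine and_congr
    (eq_iff_eq_of_sub_eq_mul_sub (mul_ne_zero four_mul_pi_sq_ne_zero (b := -1) (by norm_num)) ?_)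
    (eq_iff_eq_of_sub_eq_mul_sub
      (mul_ne_zero two_mul_pi_complex_ne_zero (b := -1) (by norm_num)) ?_) <;>
  · simp
    ring

theorem Torelli_mem_Hki_one (k : ℤ) (p : (Fin 4 → ℝ) × (Fin 4 → ℂ)) :
    Torelli p ∈ Hki k 1 ↔ p ∈ Hde (-k - 2) ![false, false, true, true] := by
  simp only [Torelli, Tmap, TCmap, Hki, Hde, Fin.sum_univ_four, Set.mem_ofPred_eq]
  refine and_congr
    (eq_iff_eq_of_sub_eq_mul_sub (mul_ne_zero four_mul_pi_sq_ne_zero (b := 1) (by norm_num)) ?_)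
    (eq_iff_eq_of_sub_eq_mul_sub
      (mul_ne_zero two_mul_pi_complex_ne_zero (b := 1) (by norm_num)) ?_) <;>
  · simp
    ring

theorem Torelli_mem_Hki_two (k : ℤ) (p : (Fin 4 → ℝ) × (Fin 4 → ℂ)) :
    Torelli p ∈ Hki k 2 ↔ p ∈ Hde (-k - 2) ![false, true, false, true] := by
  simp only [Torelli, Tmap, TCmap, Hki, Hde, Fin.sum_univ_four, Set.mem_ofPred_eq]
  refine and_congr
    (eq_iff_eq_of_sub_eq_mul_sub (mul_ne_zero four_mul_pi_sq_ne_zero (b := 1) (by norm_num)) ?_)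
    (eq_iff_eq_of_sub_eq_mul_sub
      (mul_ne_zero two_mul_pi_complex_ne_zero (b := 1) (by norm_num)) ?_) <;>
  · simp
    ring

theorem Torelli_mem_Hki_three (k : ℤ) (p : (Fin 4 → ℝ) × (Fin 4 → ℂ)) :
    Torelli p ∈ Hki k 3 ↔ p ∈ Hde (-k - 2) ![false, true, true, false] := by
  simp only [Torelli, Tmap, TCmap, Hki, Hde, Fin.sum_univ_four, Set.mem_ofPred_eq]
  refine and_congr
    (eq_iff_eq_of_sub_eq_mul_sub (mul_ne_zero four_mul_pi_sq_ne_zero (b := 1) (by norm_num)) ?_)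
    (eq_iff_eq_of_sub_eq_mul_sub
      (mul_ne_zero two_mul_pi_complex_ne_zero (b := 1) (by norm_num)) ?_) <;>
  · simp
    ring

theorem Torelli_mem_Hk (k : ℤ) (p : (Fin 4 → ℝ) × (Fin 4 → ℂ)) :
    Torelli p ∈ Hk k ↔ p ∈ Hde (-k - 3) ![false, true, true, true] := by
  simp only [Torelli, Tmap, TCmap, Hk, Hde, Fin.sum_univ_four, Set.mem_ofPred_eq]
  refine and_congr
    (eq_iff_eq_of_sub_eq_mul_sub (mul_ne_zero four_mul_pi_sq_ne_zero (b := 2) (by norm_num)) ?_)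
    (eq_iff_eq_of_sub_eq_mul_sub
      (mul_ne_zero two_mul_pi_complex_ne_zero (b := 2) (by norm_num)) ?_) <;>
  · simp
    ring

theorem Torelli_mem_Hkij_zero_one (k : ℤ) (p : (Fin 4 → ℝ) × (Fin 4 → ℂ)) :
    Torelli p ∈ Hkij k 0 1 ↔ p ∈ Hde (k - 1) ![false, true, false, false] := by
  simp only [Torelli, Tmap, TCmap, Hkij, Hde, Fin.sum_univ_four, Set.mem_ofPred_eq]
  refine and_congr
    (eq_iff_eq_of_sub_eq_mul_sub (mul_ne_zero four_mul_pi_sq_ne_zero (b := -2) (by norm_num)) ?_)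
    (eq_iff_eq_of_sub_eq_mul_sub
      (mul_ne_zero two_mul_pi_complex_ne_zero (b := -2) (by norm_num)) ?_) <;>
  · simp
    ring

theorem Torelli_mem_Hkij_zero_two (k : ℤ) (p : (Fin 4 → ℝ) × (Fin 4 → ℂ)) :
    Torelli p ∈ Hkij k 0 2 ↔ p ∈ Hde (k - 1) ![false, false, true, false] := by
  simp only [Torelli, Tmap, TCmap, Hkij, Hde, Fin.sum_univ_four, Set.mem_ofPred_eq]
  refine and_congr
    (eq_iff_eq_of_sub_eq_mul_sub (mul_ne_zero four_mul_pi_sq_ne_zero (b := -2) (by norm_num)) ?_)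
    (eq_iff_eq_of_sub_eq_mul_sub
      (mul_ne_zero two_mul_pi_complex_ne_zero (b := -2) (by norm_num)) ?_) <;>
  · simp
    ring

theorem Torelli_mem_Hkij_zero_three (k : ℤ) (p : (Fin 4 → ℝ) × (Fin 4 → ℂ)) :
    Torelli p ∈ Hkij k 0 3 ↔ p ∈ Hde (k - 1) ![false, false, false, true] := by
  simp only [Torelli, Tmap, TCmap, Hkij, Hde, Fin.sum_univ_four, Set.mem_ofPred_eq]
  refine and_congr
    (eq_iff_eq_of_sub_eq_mul_sub (mul_ne_zero four_mul_pi_sq_ne_zero (b := -2) (by norm_num)) ?_)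
    (eq_iff_eq_of_sub_eq_mul_sub
      (mul_ne_zero two_mul_pi_complex_ne_zero (b := -2) (by norm_num)) ?_) <;>
  · simp
    ring

theorem Torelli_mem_Hkij_one_two (k : ℤ) (p : (Fin 4 → ℝ) × (Fin 4 → ℂ)) :
    Torelli p ∈ Hkij k 1 2 ↔ p ∈ Hde (-k - 2) ![false, false, false, true] := by
  simp only [Torelli, Tmap, TCmap, Hkij, Hde, Fin.sum_univ_four, Set.mem_ofPred_eq]
  refine and_congr
    (eq_iff_eq_of_sub_eq_mul_sub (mul_ne_zero four_mul_pi_sq_ne_zero (b := 2) (by norm_num)) ?_)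
    (eq_iff_eq_of_sub_eq_mul_sub
      (mul_ne_zero two_mul_pi_complex_ne_zero (b := 2) (by norm_num)) ?_) <;>
  · simp
    ring

theorem Torelli_mem_Hkij_one_three (k : ℤ) (p : (Fin 4 → ℝ) × (Fin 4 → ℂ)) :
    Torelli p ∈ Hkij k 1 3 ↔ p ∈ Hde (-k - 2) ![false, false, true, false] := by
  simp only [Torelli, Tmap, TCmap, Hkij, Hde, Fin.sum_univ_four, Set.mem_ofPred_eq]
  refine and_congr
    (eq_iff_eq_of_sub_eq_mul_sub (mul_ne_zero four_mul_pi_sq_ne_zero (b := 2) (by norm_num)) ?_)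
    (eq_iff_eq_of_sub_eq_mul_sub
      (mul_ne_zero two_mul_pi_complex_ne_zero (b := 2) (by norm_num)) ?_) <;>
  · simp
    ring

theorem Torelli_mem_Hkij_two_three (k : ℤ) (p : (Fin 4 → ℝ) × (Fin 4 → ℂ)) :
    Torelli p ∈ Hkij k 2 3 ↔ p ∈ Hde (-k - 2) ![false, true, false, false] := by
  simp only [Torelli, Tmap, TCmap, Hkij, Hde, Fin.sum_univ_four, Set.mem_ofPred_eq]
  refine and_congr
    (eq_iff_eq_of_sub_eq_mul_sub (mul_ne_zero four_mul_pi_sq_ne_zero (b := 2) (by norm_num)) ?_)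
    (eq_iff_eq_of_sub_eq_mul_sub
      (mul_ne_zero two_mul_pi_complex_ne_zero (b := 2) (by norm_num)) ?_) <;>
  · simp
    ring

theorem Torelli_mem_Hki_prime_zero (k : ℤ) (p : (Fin 4 → ℝ) × (Fin 4 → ℂ)) :
    Torelli p ∈ Hki' k 0 ↔ p ∈ Hdi (-k) 0 := by
  simp only [Torelli, Tmap, TCmap, Hki', Hdi, Fin.sum_univ_four, Set.mem_ofPred_eq]
  refine and_congr
    (eq_iff_eq_of_sub_eq_mul_sub (mul_ne_zero four_mul_pi_sq_ne_zero (b := -2) (by norm_num)) ?_)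
    (eq_iff_eq_of_sub_eq_mul_sub
      (mul_ne_zero two_mul_pi_complex_ne_zero (b := -4) (by norm_num)) ?_) <;>
  · simp
    ring

theorem Torelli_mem_Hki_prime_one (k : ℤ) (p : (Fin 4 → ℝ) × (Fin 4 → ℂ)) :
    Torelli p ∈ Hki' k 1 ↔ p ∈ Hdi (k + 1) 1 := by
  simp only [Torelli, Tmap, TCmap, Hki', Hdi, Fin.sum_univ_four, Set.mem_ofPred_eq]
  refine and_congr
    (eq_iff_eq_of_sub_eq_mul_sub (mul_ne_zero four_mul_pi_sq_ne_zero (b := 2) (by norm_num)) ?_)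
    (eq_iff_eq_of_sub_eq_mul_sub
      (mul_ne_zero two_mul_pi_complex_ne_zero (b := 4) (by norm_num)) ?_) <;>
  · simp
    ring

theorem Torelli_mem_Hki_prime_two (k : ℤ) (p : (Fin 4 → ℝ) × (Fin 4 → ℂ)) :
    Torelli p ∈ Hki' k 2 ↔ p ∈ Hdi (k + 1) 2 := by
  simp only [Torelli, Tmap, TCmap, Hki', Hdi, Fin.sum_univ_four, Set.mem_ofPred_eq]
  refine and_congr
    (eq_iff_eq_of_sub_eq_mul_sub (mul_ne_zero four_mul_pi_sq_ne_zero (b := 2) (by norm_num)) ?_)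
    (eq_iff_eq_of_sub_eq_mul_sub
      (mul_ne_zero two_mul_pi_complex_ne_zero (b := 4) (by norm_num)) ?_) <;>
  · simp
    ring

theorem Torelli_mem_Hki_prime_three (k : ℤ) (p : (Fin 4 → ℝ) × (Fin 4 → ℂ)) :
    Torelli p ∈ Hki' k 3 ↔ p ∈ Hdi (k + 1) 3 := by
  simp only [Torelli, Tmap, TCmap, Hki', Hdi, Fin.sum_univ_four, Set.mem_ofPred_eq]
  refine and_congr
    (eq_iff_eq_of_sub_eq_mul_sub (mul_ne_zero four_mul_pi_sq_ne_zero (b := 2) (by norm_num)) ?_)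
    (eq_iff_eq_of_sub_eq_mul_sub
      (mul_ne_zero two_mul_pi_complex_ne_zero (b := 4) (by norm_num)) ?_) <;>
  · simp
    ring

theorem mem_Rfull {p : (Fin 4 → ℝ) × (Fin 4 → ℂ)} :
    p ∈ Rfull ↔ (∀ d e, p ∉ Hde d e) ∧ ∀ d i, p ∉ Hdi d i := by
  simp [Rfull]

theorem mem_Pdom {p : (Fin 4 → ℝ) × (Fin 4 → ℂ)} :
    p ∈ Pdom ↔ (∀ k, p ∉ Hk k) ∧ (∀ k i, p ∉ Hki k i) ∧ (∀ k i, p ∉ Hki' k i) ∧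
      ∀ k i j, i ≠ j → p ∉ Hkij k i j := by
  simp only [Pdom, Set.mem_sdiff, Set.mem_univ, true_and, Set.mem_iUnion, Set.mem_union,
    not_exists, not_or, forall_and, and_assoc]

theorem Torelli_mem_Pdom_of_mem_Rfull {p : (Fin 4 → ℝ) × (Fin 4 → ℂ)} (hp : p ∈ Rfull) :
    Torelli p ∈ Pdom := by
  obtain ⟨he, hi⟩ := mem_Rfull.1 hp
  have hlt (k : ℤ) (i j : Fin 4) (hij : i < j) : Torelli p ∉ Hkij k i j := by
    fin_cases i <;> fin_cases j <;> simp at hij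
    · exact (Torelli_mem_Hkij_zero_one k p).not.2 (he _ _)
    · exact (Torelli_mem_Hkij_zero_two k p).not.2 (he _ _)
    · exact (Torelli_mem_Hkij_zero_three k p).not.2 (he _ _)
    · exact (Torelli_mem_Hkij_one_two k p).not.2 (he _ _)
    · exact (Torelli_mem_Hkij_one_three k p).not.2 (he _ _)
    · exact (Torelli_mem_Hkij_two_three k p).not.2 (he _ _)
  refine mem_Pdom.2 ⟨fun k => (Torelli_mem_Hk k p).not.2 (he _ _), fun k i => ?_, fun k i => ?_,
    fun k i j hij => ?_⟩
  · fin_cases i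
    · exact (Torelli_mem_Hki_zero k p).not.2 (he _ _)
    · exact (Torelli_mem_Hki_one k p).not.2 (he _ _)
    · exact (Torelli_mem_Hki_two k p).not.2 (he _ _)
    · exact (Torelli_mem_Hki_three k p).not.2 (he _ _)
  · fin_cases i
    · exact (Torelli_mem_Hki_prime_zero k p).not.2 (hi _ _)
    · exact (Torelli_mem_Hki_prime_one k p).not.2 (hi _ _)
    · exact (Torelli_mem_Hki_prime_two k p).not.2 (hi _ _)
    · exact (Torelli_mem_Hki_prime_three k p).not.2 (hi _ _)
  · rcases lt_or_gt_of_ne hij with h | h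
    · exact hlt k i j h
    · rw [Hkij_comm]
      exact hlt k j i h

theorem mem_Rfull_of_Torelli_mem_Pdom {p : (Fin 4 → ℝ) × (Fin 4 → ℂ)}
    (hp : Torelli p ∈ Pdom) : p ∈ Rfull := by
  obtain ⟨hk, hki, hki', hkij⟩ := mem_Pdom.1 hp
  have hde (d : ℤ) (a b c : Bool) : p ∉ Hde d ![false, a, b, c] := by
    cases a <;> cases b <;> cases c
    · simpa using (Torelli_mem_Hki_zero (d + 1) p).not.1 (hki _ _)
    · simpa using (Torelli_mem_Hkij_zero_three (d + 1) p).not.1 (hkij _ _ _ (by decide))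
    · simpa using (Torelli_mem_Hkij_zero_two (d + 1) p).not.1 (hkij _ _ _ (by decide))
    · simpa using (Torelli_mem_Hki_one (-d - 2) p).not.1 (hki _ _)
    · simpa using (Torelli_mem_Hkij_zero_one (d + 1) p).not.1 (hkij _ _ _ (by decide))
    · simpa using (Torelli_mem_Hki_two (-d - 2) p).not.1 (hki _ _)
    · simpa using (Torelli_mem_Hki_three (-d - 2) p).not.1 (hki _ _)
    · simpa using (Torelli_mem_Hk (-d - 3) p).not.1 (hk _)
  have hde_of_false (d : ℤ) (e : Fin 4 → Bool) (h0 : e 0 = false) : p ∉ Hde d e := by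
    have : e = ![false, e 1, e 2, e 3] := by
      ext i
      fin_cases i <;> simp [h0]
    rw [this]
    exact hde _ _ _ _
  refine mem_Rfull.2 ⟨fun d e => ?_, fun d i => ?_⟩
  · cases h0 : e 0
    · exact hde_of_false d e h0
    · rw [← Hde_not]
      exact hde_of_false _ _ (by simp [h0])
  · fin_cases i
    · simpa using (Torelli_mem_Hki_prime_zero (-d) p).not.1 (hki' _ _)
    · simpa using (Torelli_mem_Hki_prime_one (d - 1) p).not.1 (hki' _ _)
    · simpa using (Torelli_mem_Hki_prime_two (d - 1) p).not.1 (hki' _ _)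
    · simpa using (Torelli_mem_Hki_prime_three (d - 1) p).not.1 (hki' _ _)

theorem Tmap_injective : Function.Injective Tmap := by
  intro a b h
  have hc := four_mul_pi_sq_ne_zero
  have h0 := mul_left_cancel₀ hc (congrFun h 0)
  have h1 := mul_left_cancel₀ hc (congrFun h 1)
  have h2 := mul_left_cancel₀ hc (congrFun h 2)
  have h3 := mul_left_cancel₀ hc (congrFun h 3)
  ext i
  fin_cases i <;> dsimp
  · linear_combination (-h0 + h1 + h2 + h3) / 4
  · linear_combination (-h0 + h1 - h2 - h3) / 4
  · linear_combination (-h0 - h1 + h2 - h3) / 4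
  · linear_combination (-h0 - h1 - h2 + h3) / 4

theorem TCmap_injective : Function.Injective TCmap := by
  intro a b h
  have hc := two_mul_pi_complex_ne_zero
  have h0 := mul_left_cancel₀ hc (congrFun h 0)
  have h1 := mul_left_cancel₀ hc (congrFun h 1)
  have h2 := mul_left_cancel₀ hc (congrFun h 2)
  have h3 := mul_left_cancel₀ hc (congrFun h 3)
  funext i
  fin_cases i <;> dsimp
  · linear_combination (-h0 + h1 + h2 + h3) / 4
  · linear_combination (-h0 + h1 - h2 - h3) / 4
  · linear_combination (-h0 - h1 + h2 - h3) / 4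
  · linear_combination (-h0 - h1 - h2 + h3) / 4

theorem Tmap_surjective : Function.Surjective Tmap := by
  intro x
  have hpi := pi_ne_zero
  refine ⟨![(1 + (-x 0 + x 1 + x 2 + x 3) / (4 * π ^ 2)) / 4,
    (1 + (-x 0 + x 1 - x 2 - x 3) / (4 * π ^ 2)) / 4,
    (1 + (-x 0 - x 1 + x 2 - x 3) / (4 * π ^ 2)) / 4,
    (1 + (-x 0 - x 1 - x 2 + x 3) / (4 * π ^ 2)) / 4], ?_⟩
  ext i
  fin_cases i <;> simp [Tmap] <;> field_simp <;> ring

theorem TCmap_surjective : Function.Surjective TCmap := by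
  intro z
  have hpi : (π : ℂ) ≠ 0 := Complex.ofReal_ne_zero.2 pi_ne_zero
  refine ⟨![(-z 0 + z 1 + z 2 + z 3) / (8 * π), (-z 0 + z 1 - z 2 - z 3) / (8 * π),
    (-z 0 - z 1 + z 2 - z 3) / (8 * π), (-z 0 - z 1 - z 2 + z 3) / (8 * π)], ?_⟩
  funext i
  fin_cases i <;> simp [TCmap] <;> field_simp <;> ring

theorem Torelli_bijOn : Set.BijOn Torelli Rfull Pdom := by
  refine ⟨fun p hp => Torelli_mem_Pdom_of_mem_Rfull hp,
    (Tmap_injective.prodMap TCmap_injective).injOn, fun q hq => ?_⟩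
  obtain ⟨p, rfl⟩ := (Tmap_surjective.prodMap TCmap_surjective) q
  exact ⟨p, mem_Rfull_of_Torelli_mem_Pdom hq, rfl⟩

/-- The extended Torelli map maps `R̃^full` bijectively onto the period domain `𝒫`. -/
theorem stmt12 : Torelli '' Rfull = Pdom ∧ Set.BijOn Torelli Rfull Pdom := by
  exact ⟨Torelli_bijOn.image_eq, Torelli_bijOn⟩
end
end

section
/- Let 𝓡 = ((0,1/2)⁴ × ℂ⁴) ∖ ⋃_{d ∈ ℤ, e ∈ {0,1}⁴} H_{d,e} ⊆ ℝ⁴ × ℂ⁴. Then 𝓡, equipped with the subspace topology, is path-connected and simply connected. -/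
open Real

noncomputable section

/-- The set `𝓡` of generic parabolic parameters:
`𝓡 = ((0,1/2)⁴ × ℂ⁴) \ ⋃_{d,e} H_{d,e}`. -/
def Rgen : Set ((Fin 4 → ℝ) × (Fin 4 → ℂ)) :=
  {p | ∀ i : Fin 4, p.1 i ∈ Set.Ioo (0 : ℝ) (1 / 2)} \
    ⋃ (d : ℤ) (e : Fin 4 → Bool), Hde d e

open Set Topology unitInterval Module

/-- A loop that is freely homotopic to a constant, through loops, is null-homotopic. -/
theorem Path.homotopic_refl_of_free_homotopy {X : Type*} [TopologicalSpace X] {x : X}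
    (γ : Path x x) (F : C(I × I, X)) (c : X) (h0 : ∀ t, F (0, t) = γ t)
    (h1 : ∀ t, F (1, t) = c) (hloop : ∀ s, F (s, 0) = F (s, 1)) :
    γ.Homotopic (Path.refl x) := by
  let lower : Path ((0, 0) : I × I) (0, 1) := ⟨⟨fun t => (0, t), by fun_prop⟩, rfl, rfl⟩
  let left : Path ((0, 0) : I × I) (1, 0) := ⟨⟨fun s => (s, 0), by fun_prop⟩, rfl, rfl⟩
  let upper : Path ((1, 0) : I × I) (1, 1) := ⟨⟨fun t => (1, t), by fun_prop⟩, rfl, rfl⟩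
  let right : Path ((0, 1) : I × I) (1, 1) := ⟨⟨fun s => (s, 1), by fun_prop⟩, rfl, rfl⟩
  have hx0 : x = F (0, 0) := by rw [h0, γ.source]
  have hx1 : x = F (0, 1) := by rw [h0, γ.target]
  let side : Path x c := ⟨⟨fun s => F (s, 0), by fun_prop⟩, hx0.symm, h1 0⟩
  have : ContractibleSpace I := (convex_Icc (0 : ℝ) 1).contractibleSpace ⟨0, by simp⟩
  have hsq : lower.Homotopic (left.trans (upper.trans right.symm)) :=
    SimplyConnectedSpace.paths_homotopic _ _
  have hF := (hsq.map F).pathCast hx0 hx1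
  have e1 : (lower.map F.continuous).cast hx0 hx1 = γ := by
    ext t; exact h0 t
  have e2 : ((left.trans (upper.trans right.symm)).map F.continuous).cast hx0 hx1 =
      side.trans ((Path.refl c).trans side.symm) := by
    ext t
    simp only [Path.cast_coe, Path.map_coe, Function.comp_apply, Path.trans_apply]
    split_ifs
    · rfl
    · exact h1 _
    · exact (hloop _).symm
  rw [e1, e2] at hF
  refine hF.trans ?_
  rw [← Path.Homotopic.Quotient.eq]
  simp

/-- In an open subset of a normed space, every path is homotopic to one of class `C¹`. -/
theorem Path.exists_contDiff_homotopic {E : Type*} [NormedAddCommGroup E] [NormedSpace ℝ E]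
    {U : Set E} (hU : IsOpen U) {x y : U} (γ : Path x y) :
    ∃ g : ℝ → E, ContDiff ℝ 1 g ∧ ∃ p : Path x y, (∀ t : I, (p t : E) = g t) ∧
      γ.Homotopic p := by
  obtain ⟨δ, hδ, hδU⟩ : ∃ δ > 0, Metric.thickening δ (range fun t => (γ t : E)) ⊆ U :=
    (isCompact_range (by fun_prop)).exists_thickening_subset_open hU
      (range_subset_iff.2 fun t => (γ t).2)
  have hball : ∀ t z, dist z (γ t : E) < δ → z ∈ U := fun t z hz =>
    hδU (Metric.mem_thickening_iff.2 ⟨_, mem_range_self t, hz⟩)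
  have hext : Continuous fun t : ℝ => (γ.extend t : E) :=
    continuous_subtype_val.comp γ.continuous_extend
  obtain ⟨f, hf, hfγ, -⟩ := hext.exists_contDiff_approx 1 (ε := fun _ => δ / 2)
    continuous_const (fun _ => half_pos hδ)
  have hfI : ∀ t : I, ‖f t - γ t‖ < δ / 2 := fun t => by
    simpa [dist_eq_norm] using hfγ t
  set g : ℝ → E := fun t => f t - ((1 - t) • (f 0 - x) + t • (f 1 - y)) with hg
  have hgC : ContDiff ℝ 1 g := by
    have : ContDiff ℝ 1 f := hf
    fun_prop
  have hgγ : ∀ t : I, ‖g t - γ t‖ < δ := fun t => by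
    have hcorr : (1 - (t : ℝ)) • (f 0 - x) + (t : ℝ) • (f 1 - y) ∈ Metric.ball (0 : E) (δ / 2) := by
      refine convex_ball (0 : E) (δ / 2) ?_ ?_ (sub_nonneg.2 t.2.2) t.2.1 (by ring)
      · simpa using hfI 0
      · simpa using hfI 1
    rw [mem_ball_zero_iff] at hcorr
    have hsplit : g t - γ t =
        (f t - γ t) - ((1 - (t : ℝ)) • (f 0 - x) + (t : ℝ) • (f 1 - y)) := by
      simp only [hg]; abel
    rw [hsplit]
    linarith [norm_sub_le (f t - γ t) ((1 - (t : ℝ)) • (f 0 - x) + (t : ℝ) • (f 1 - y)), hfI t]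
  have hline : ∀ s t : I, (γ t : E) + (s : ℝ) • (g t - γ t) ∈ U := fun s t => by
    refine hball t _ ?_
    rw [dist_eq_norm, add_sub_cancel_left, norm_smul, Real.norm_of_nonneg s.2.1]
    exact (mul_le_of_le_one_left (norm_nonneg _) s.2.2).trans_lt (hgγ t)
  have hgU : ∀ t : I, g t ∈ U := fun t => by simpa using hline 1 t
  have hgc : Continuous g := hgC.continuous
  have g0 : g 0 = x := by simp [hg]
  have g1 : g 1 = y := by simp [hg]
  let p : Path x y :=
    ⟨⟨fun t => ⟨g t, hgU t⟩, by fun_prop⟩, Subtype.ext (by simpa using g0),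
      Subtype.ext (by simpa using g1)⟩
  refine ⟨g, hgC, p, fun _ => rfl, ⟨⟨⟨⟨fun q => ⟨_, hline q.1 q.2⟩, by fun_prop⟩, ?_, ?_⟩, ?_⟩⟩⟩
  · intro t
    simp
  · intro t
    ext
    simp [p]
  · rintro s t (rfl | rfl)
    · ext
      simp [g0]
    · ext
      simp [g1]

/-- For a `C¹` curve `g` and countably many affine subspaces of codimension at least three,
a generic point `c` is such that the cone over `g` with apex `c` meets these subspaces only
along `g`. -/
theorem exists_generic_cone_apex {E ι : Type*} [NormedAddCommGroup E] [NormedSpace ℝ E]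
    [FiniteDimensional ℝ E] [Countable ι] [Nonempty ι] (p : ι → E) (K : ι → Submodule ℝ E)
    (hK : ∀ i, finrank ℝ (K i) + 3 ≤ finrank ℝ E)
    {D : Set E} (hD : IsOpen D) (hne : D.Nonempty)
    {g : ℝ → E} (hg : ContDiff ℝ 1 g) :
    ∃ c ∈ D, ∀ t s : ℝ, s ≠ 0 → ∀ i, (1 - s) • g t + s • c - p i ∉ K i := by
  let Φ (i : ι) : K i × ℝ × ℝ → E := fun q => q.1 + q.2.1 • p i + (1 - q.2.1) • g q.2.2
  have hΦ : ∀ i, ContDiff ℝ 1 (Φ i) := fun i => by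
    have : ContDiff ℝ 1 fun q : K i × ℝ × ℝ => (q.1 : E) :=
      (K i).subtypeL.contDiff.comp contDiff_fst
    fun_prop
  have hdim : dimH (⋃ i, range (Φ i)) < finrank ℝ E := by
    have hle : dimH (⋃ i, range (Φ i)) ≤ ((finrank ℝ E - 1 : ℕ) : ENNReal) := by
      rw [dimH_iUnion]
      refine iSup_le fun i => (hΦ i).dimH_range_le.trans ?_
      have := hK i
      simp only [finrank_prod, finrank_self]
      exact_mod_cast (by omega)
    refine hle.trans_lt ?_
    have := hK (Classical.arbitrary ι)
    exact_mod_cast (by omega : finrank ℝ E - 1 < finrank ℝ E)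
  obtain ⟨c, hc, hcD⟩ := (dense_compl_of_dimH_lt_finrank hdim).exists_mem_open hD hne
  refine ⟨c, hcD, fun t s hs i hmem => hc (mem_iUnion.2 ⟨i, ?_⟩)⟩
  refine ⟨(s⁻¹ • ⟨_, hmem⟩, s⁻¹, t), ?_⟩
  simp only [Φ, Submodule.coe_smul, smul_sub, smul_add, smul_smul, sub_smul,
    inv_mul_cancel₀ hs, one_smul]
  abel

/-- The complement of countably many affine subspaces of codimension at least three in a convex
open set is simply connected, as soon as it is open. -/
theorem simplyConnectedSpace_convex_diff_affine {E ι : Type*} [NormedAddCommGroup E]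
    [NormedSpace ℝ E] [FiniteDimensional ℝ E] [Countable ι] [Nonempty ι]
    (p : ι → E) (K : ι → Submodule ℝ E)
    (hK : ∀ i, finrank ℝ (K i) + 3 ≤ finrank ℝ E) {D : Set E} (hD : IsOpen D) (hconv : Convex ℝ D)
    (hne : D.Nonempty) {U : Set E} (hU : IsOpen U)
    (hmem : ∀ x, x ∈ U ↔ x ∈ D ∧ ∀ i, x - p i ∉ K i) : SimplyConnectedSpace U := by
  have cone : ∀ g : ℝ → E, ContDiff ℝ 1 g →
      ∃ c, ∀ t, g t ∈ U → ∀ s : I, (1 - (s : ℝ)) • g t + (s : ℝ) • c ∈ U := by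
    intro g hg
    obtain ⟨c, hcD, hc⟩ := exists_generic_cone_apex p K hK hD hne hg
    refine ⟨c, fun t ht s => ?_⟩
    by_cases hs : (s : ℝ) = 0
    · simpa [hs] using ht
    · exact (hmem _).2 ⟨hconv ((hmem _).1 ht).1 hcD (sub_nonneg.2 s.2.2) s.2.1 (by ring),
        fun i => hc t s hs i⟩
  rw [simply_connected_iff_loops_nullhomotopic]
  constructor
  · have hUne : U.Nonempty := by
      obtain ⟨c, hcD, hc⟩ := exists_generic_cone_apex p K hK hD hne (g := fun _ => 0) contDiff_const
      exact ⟨c, (hmem c).2 ⟨hcD, fun i => by simpa using hc 0 1 one_ne_zero i⟩⟩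
    refine isPathConnected_iff_pathConnectedSpace.1 ?_
    obtain ⟨x₀, hx₀⟩ := hUne
    refine ⟨x₀, hx₀, fun {y} hy => ?_⟩
    obtain ⟨c, hc⟩ := cone (AffineMap.lineMap x₀ y) (by
      simp only [AffineMap.coe_lineMap, vsub_eq_sub, vadd_eq_add]
      fun_prop)
    have hjoin : ∀ t : ℝ, AffineMap.lineMap x₀ y t ∈ U → JoinedIn U (AffineMap.lineMap x₀ y t) c := by
      intro t ht
      refine JoinedIn.of_segment_subset ?_
      rintro _ ⟨a, b, ha, hb, hab, rfl⟩
      obtain rfl : a = 1 - b := eq_sub_of_add_eq hab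
      exact hc t ht ⟨b, hb, by linarith⟩
    have h0 := hjoin 0 (by simpa using hx₀)
    have h1 := hjoin 1 (by simpa using hy)
    simp only [AffineMap.lineMap_apply_zero, AffineMap.lineMap_apply_one] at h0 h1
    exact h0.trans h1.symm
  · intro x γ
    obtain ⟨g, hg, q, hq, hγq⟩ := γ.exists_contDiff_homotopic hU
    obtain ⟨c, hc⟩ := cone g hg
    have hgU : ∀ t : I, g t ∈ U := fun t => hq t ▸ (q t).2
    have hgc : Continuous g := hg.continuous
    have hcU : c ∈ U := by simpa using hc _ (hgU 0) 1
    refine hγq.trans (q.homotopic_refl_of_free_homotopy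
      ⟨fun z => ⟨_, hc _ (hgU z.2) z.1⟩, by fun_prop⟩ ⟨c, hcU⟩ ?_ ?_ ?_)
    · intro t
      ext
      simp [hq]
    · intro t
      ext
      simp
    · intro s
      ext
      simp only [ContinuousMap.coe_mk, ← hq, q.source, q.target]

/-- The linear part of the equations of `Hde d e`. -/
def HdeLinear (e : Fin 4 → Bool) : ((Fin 4 → ℝ) × (Fin 4 → ℂ)) →ₗ[ℝ] ℝ × ℂ where
  toFun p := (∑ i, (if e i then (-1 : ℝ) else 1) * p.1 i,
    ∑ i, (if e i then (-1 : ℂ) else 1) * p.2 i)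
  map_add' p q := by
    simp [mul_add, Finset.sum_add_distrib]
  map_smul' c p := by
    simp [Finset.mul_sum, mul_left_comm]

theorem HdeLinear_surjective (e : Fin 4 → Bool) : Function.Surjective (HdeLinear e) := by
  rintro ⟨r, z⟩
  refine ⟨(Pi.single 0 ((if e 0 then (-1 : ℝ) else 1) * r),
    Pi.single 0 ((if e 0 then (-1 : ℂ) else 1) * z)), ?_⟩
  cases h : e 0 <;> simp [HdeLinear, Fin.sum_univ_four, h]

theorem finrank_ker_HdeLinear (e : Fin 4 → Bool) :
    finrank ℝ (LinearMap.ker (HdeLinear e)) + 3 =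
      finrank ℝ ((Fin 4 → ℝ) × (Fin 4 → ℂ)) := by
  have h := (HdeLinear e).finrank_range_add_finrank_ker
  rw [LinearMap.range_eq_top.2 (HdeLinear_surjective e), finrank_top] at h
  have h3 : finrank ℝ (ℝ × ℂ) = 3 := by
    simp [Complex.finrank_real_complex]
  omega

theorem mem_Hde_iff (d : ℤ) (e : Fin 4 → Bool) (p : (Fin 4 → ℝ) × (Fin 4 → ℂ)) :
    p ∈ Hde d e ↔
      HdeLinear e p = (-((d + ∑ i, (if e i then 1 else 0) : ℤ) : ℝ), 0) := by
  simp only [Hde, mem_ofPred_eq, HdeLinear, LinearMap.coe_mk, AddHom.coe_mk, Prod.mk.injEq,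
    Finset.sum_add_distrib]
  push_cast
  refine and_congr_left fun _ => ?_
  constructor <;> intro h <;> linarith

theorem isClosed_iUnion_Hde : IsClosed (⋃ (d : ℤ) (e : Fin 4 → Bool), Hde d e) := by
  have h : (⋃ (d : ℤ) (e : Fin 4 → Bool), Hde d e) =
      ⋃ e : Fin 4 → Bool, HdeLinear e ⁻¹' (range ((↑) : ℤ → ℝ) ×ˢ {0}) := by
    ext p
    simp only [mem_iUnion, mem_Hde_iff, mem_preimage, mem_prod, mem_range, mem_singleton_iff,
      Prod.ext_iff]
    constructor
    · rintro ⟨d, e, h1, h2⟩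
      exact ⟨e, ⟨-(d + ∑ i, (if e i then 1 else 0)), by rw [h1]; push_cast; rfl⟩, h2⟩
    · rintro ⟨e, ⟨n, h1⟩, h2⟩
      exact ⟨-n - ∑ i, (if e i then 1 else 0), e, by rw [← h1]; push_cast; ring, h2⟩
  rw [h]
  exact isClosed_iUnion_of_finite fun e =>
    (Int.isClosedEmbedding_coe_real.isClosed_range.prod isClosed_singleton).preimage
      (HdeLinear e).continuous_of_finiteDimensional

/-- `𝓡`, with the subspace topology, is path-connected and simply connected. -/
theorem stmt14 : PathConnectedSpace ↥Rgen ∧ SimplyConnectedSpace ↥Rgen := by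
  suffices h : SimplyConnectedSpace Rgen from ⟨inferInstance, h⟩
  have hDopen : IsOpen {p : (Fin 4 → ℝ) × (Fin 4 → ℂ) | ∀ i, p.1 i ∈ Ioo (0 : ℝ) (1 / 2)} := by
    simp only [ofPred_forall]
    exact isOpen_iInter_of_finite fun i => isOpen_Ioo.preimage (by fun_prop)
  have hDconv : Convex ℝ {p : (Fin 4 → ℝ) × (Fin 4 → ℂ) | ∀ i, p.1 i ∈ Ioo (0 : ℝ) (1 / 2)} :=
    fun p hp q hq a b ha hb hab i => convex_Ioo (0 : ℝ) (1 / 2) (hp i) (hq i) ha hb hab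
  choose p hp using fun i : ℤ × (Fin 4 → Bool) => HdeLinear_surjective i.2
    (-((i.1 + ∑ j, (if i.2 j then 1 else 0) : ℤ) : ℝ), 0)
  refine simplyConnectedSpace_convex_diff_affine p (fun i => LinearMap.ker (HdeLinear i.2))
    (fun i => (finrank_ker_HdeLinear i.2).le) hDopen hDconv
    ⟨(fun _ => 1 / 4, 0), fun i => by norm_num⟩ (hDopen.sdiff isClosed_iUnion_Hde) fun x => ?_
  simp only [Rgen, mem_sdiff, mem_iUnion, not_exists, LinearMap.mem_ker, map_sub, hp, sub_eq_zero,
    Prod.forall, mem_Hde_iff]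
end
end

section
/- Let G be the subgroup of the group of bijections of ℝ⁴ (under composition) generated by r₀, r₁, r₂, r₃, r₄. For a subset I ⊆ {1,2,3,4} let v_I ∈ ℝ⁴ be the point whose i-th coordinate is 1/2 if i ∈ I and 0 otherwise (so the v_I are the 16 vertices of the cube [0,1/2]⁴). Then for all I, J ⊆ {1,2,3,4}: there exists g ∈ G with g(v_I) = v_J if and only if J = I, or J = {1,2,3,4} ∖ I, or both |I| and |J| are odd. In particular the 16 vertices form exactly 5 G-orbit classes: {v_∅, v_{{1,2,3,4}}}, {v_{{1,2}}, v_{{3,4}}}, {v_{{1,3}}, v_{{2,4}}}, {v_{{1,4}}, v_{{2,3}}}, and the 8 vertices v_I with |I| odd. -/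
open Real

noncomputable section

/-- The bijections of `ℝ⁴` whose underlying function is one of `r₀,…,r₄`. -/
def genSet : Set (Equiv.Perm (Fin 4 → ℝ)) :=
  {σ | ∃ i : Fin 5, ⇑σ = rr i}

/-- The vertex `v_I` of the cube `[0,1/2]⁴` associated to `I ⊆ {1,2,3,4}`. -/
def vI (I : Finset (Fin 4)) : Fin 4 → ℝ :=
  fun i => if i ∈ I then 1 / 2 else 0

theorem rr_involutive (i : Fin 5) : Function.Involutive (rr i) := by
  intro a
  ext j
  fin_cases i <;> fin_cases j <;> simp [rr, coefVec, coefC, Fin.sum_univ_four] <;> ring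

/-- Two points lie in the same orbit of the group generated by `r₀,…,r₄`. -/
def SameOrbit (a b : Fin 4 → ℝ) : Prop :=
  ∃ g ∈ Subgroup.closure genSet, g a = b

theorem SameOrbit.refl (a : Fin 4 → ℝ) : SameOrbit a a :=
  ⟨1, one_mem _, rfl⟩

theorem SameOrbit.symm {a b : Fin 4 → ℝ} (h : SameOrbit a b) : SameOrbit b a := by
  obtain ⟨g, hg, rfl⟩ := h
  exact ⟨g⁻¹, inv_mem hg, by simp⟩

theorem SameOrbit.trans {a b c : Fin 4 → ℝ} (hab : SameOrbit a b) (hbc : SameOrbit b c) :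
    SameOrbit a c := by
  obtain ⟨g, hg, rfl⟩ := hab
  obtain ⟨h, hh, rfl⟩ := hbc
  exact ⟨h * g, mul_mem hh hg, rfl⟩

theorem SameOrbit.rr {a b : Fin 4 → ℝ} (h : SameOrbit a b) (i : Fin 5) :
    SameOrbit a (rr i b) :=
  h.trans ⟨(rr_involutive i).toPerm, Subgroup.subset_closure ⟨i, rfl⟩, rfl⟩

/-- The points congruent to `v_I` modulo the lattice of Hurwitz quaternions
`ℤ⁴ ∪ (ℤ + 1/2)⁴`. -/
def hurwitzCoset (I : Finset (Fin 4)) : Set (Fin 4 → ℝ) :=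
  {a | ∃ (p : ℤ) (m : Fin 4 → ℤ), ∀ i, a i = vI I i + p / 2 + m i}

theorem vI_mem_hurwitzCoset_self (I : Finset (Fin 4)) : vI I ∈ hurwitzCoset I :=
  ⟨0, 0, by simp⟩

theorem eq_or_eq_compl_of_vI_mem_hurwitzCoset {I J : Finset (Fin 4)}
    (h : vI J ∈ hurwitzCoset I) : J = I ∨ J = Iᶜ := by
  obtain ⟨p, m, h⟩ := h
  have key (i : Fin 4) : (if i ∈ J then 1 else 0) = (if i ∈ I then 1 else 0) + p + 2 * m i := by
    have hi := h i
    simp only [vI] at hi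
    have : (((if i ∈ J then 1 else 0 : ℤ)) : ℝ) =
        (((if i ∈ I then 1 else 0) + p + 2 * m i : ℤ) : ℝ) := by
      push_cast
      split_ifs at hi ⊢ <;> linarith
    exact_mod_cast this
  rcases Int.even_or_odd' p with ⟨k, hk | hk⟩
  · left
    ext i
    have := key i
    split_ifs at this with hJ hI hI <;> simp [hJ, hI] <;> omega
  · right
    ext i
    have := key i
    split_ifs at this with hJ hI hI <;> simp [hJ, hI] <;> omega

theorem exists_coefVec_eq_odd (i : Fin 5) :
    ∃ d : Fin 4 → ℤ, ∀ j, coefVec i j = 2 * d j + 1 := by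
  refine ⟨![![-1, 0, 0, 0], ![0, 0, 0, 0], ![0, 0, -1, -1], ![0, -1, 0, -1],
    ![0, -1, -1, 0]] i, fun j => ?_⟩
  fin_cases i <;> fin_cases j <;> norm_num [coefVec]

theorem exists_coefC_eq_intCast (i : Fin 5) : ∃ k : ℤ, coefC i = k :=
  ⟨![0, -1, 0, 0, 0] i, by fin_cases i <;> simp [coefC]⟩

theorem rr_mem_hurwitzCoset {I : Finset (Fin 4)} (hI : Even I.card) (i : Fin 5)
    {a : Fin 4 → ℝ} (ha : a ∈ hurwitzCoset I) : rr i a ∈ hurwitzCoset I := by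
  obtain ⟨p, m, ha⟩ := ha
  obtain ⟨d, hd⟩ := exists_coefVec_eq_odd i
  obtain ⟨k, hk⟩ := exists_coefC_eq_intCast i
  obtain ⟨n, hn⟩ := hI
  have hv : ∑ j, (2 * (d j : ℝ) + 1) * vI I j = ((∑ j ∈ I, d j + n : ℤ) : ℝ) := by
    have hterm (j : Fin 4) : (2 * (d j : ℝ) + 1) * vI I j =
        if j ∈ I then (d j : ℝ) + 1 / 2 else 0 := by
      simp only [vI]
      split_ifs <;> ring
    have hn' : (I.card : ℝ) = n + n := by exact_mod_cast hn
    simp only [hterm, Finset.sum_ite_mem, Finset.univ_inter, Finset.sum_add_distrib,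
      Finset.sum_const, nsmul_eq_mul, hn']
    push_cast
    ring
  obtain ⟨t, ht⟩ : ∃ t : ℤ, (∑ j, coefVec i j * a j) + coefC i = t := by
    refine ⟨(∑ j ∈ I, d j + n) + p * (∑ j, d j + 2) + ∑ j, (2 * d j + 1) * m j + k, ?_⟩
    rw [Int.cast_add, Int.cast_add, Int.cast_add, ← hv, hk]
    simp only [hd, ha, Fin.sum_univ_four]
    push_cast
    ring
  refine ⟨p - t, fun j => m j - t * d j, fun j => ?_⟩
  simp only [rr, ht]
  rw [ha, hd]
  push_cast
  ring

theorem apply_mem_hurwitzCoset_iff {I : Finset (Fin 4)} (hI : Even I.card)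
    {g : Equiv.Perm (Fin 4 → ℝ)} (hg : g ∈ Subgroup.closure genSet) :
    ∀ a, g a ∈ hurwitzCoset I ↔ a ∈ hurwitzCoset I := by
  induction hg using Subgroup.closure_induction with
  | mem σ hσ =>
    obtain ⟨i, hi⟩ := hσ
    intro a
    rw [hi]
    refine ⟨fun h => ?_, rr_mem_hurwitzCoset hI i⟩
    simpa only [rr_involutive i a] using rr_mem_hurwitzCoset hI i h
  | one => simp
  | mul σ τ _ _ hσ hτ => intro a; rw [Equiv.Perm.mul_apply, hσ, hτ]
  | inv σ _ hσ => intro a; simpa using (hσ (σ⁻¹ a)).symm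

theorem SameOrbit.eq_or_eq_compl {I J : Finset (Fin 4)} (hI : Even I.card)
    (h : SameOrbit (vI I) (vI J)) : J = I ∨ J = Iᶜ := by
  obtain ⟨g, hg, h⟩ := h
  apply eq_or_eq_compl_of_vI_mem_hurwitzCoset
  rw [← h, apply_mem_hurwitzCoset_iff hI hg]
  exact vI_mem_hurwitzCoset_self I

theorem vI_eq_vecCons (I : Finset (Fin 4)) :
    vI I = ![if 0 ∈ I then 1 / 2 else 0, if 1 ∈ I then 1 / 2 else 0,
      if 2 ∈ I then 1 / 2 else 0, if 3 ∈ I then 1 / 2 else 0] := by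
  ext j
  fin_cases j <;> rfl

theorem rr_one_vecCons (a b c d : ℝ) :
    rr 1 ![a, b, c, d] =
      ![a - (a + b + c + d - 1) / 2, b - (a + b + c + d - 1) / 2,
        c - (a + b + c + d - 1) / 2, d - (a + b + c + d - 1) / 2] := by
  ext j
  fin_cases j <;> simp [rr, coefVec, coefC, Fin.sum_univ_four] <;> ring

theorem rr_two_vecCons (a b c d : ℝ) :
    rr 2 ![a, b, c, d] =
      ![a - (a + b - c - d) / 2, b - (a + b - c - d) / 2,
        c + (a + b - c - d) / 2, d + (a + b - c - d) / 2] := by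
  ext j
  fin_cases j <;> simp [rr, coefVec, coefC, Fin.sum_univ_four] <;> ring

theorem rr_three_vecCons (a b c d : ℝ) :
    rr 3 ![a, b, c, d] =
      ![a - (a - b + c - d) / 2, b + (a - b + c - d) / 2,
        c - (a - b + c - d) / 2, d + (a - b + c - d) / 2] := by
  ext j
  fin_cases j <;> simp [rr, coefVec, coefC, Fin.sum_univ_four] <;> ring

theorem rr_four_vecCons (a b c d : ℝ) :
    rr 4 ![a, b, c, d] =
      ![a - (a - b - c + d) / 2, b + (a - b - c + d) / 2,
        c + (a - b - c + d) / 2, d - (a - b - c + d) / 2] := by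
  ext j
  fin_cases j <;> simp [rr, coefVec, coefC, Fin.sum_univ_four] <;> ring

theorem exists_rr_vI_eq_compl {I : Finset (Fin 4)} (hI : Even I.card) :
    ∃ i, rr i (vI I) = vI Iᶜ := by
  have hmem : ∀ I : Finset (Fin 4), Even I.card →
      ((I = ∅ ∨ I = {0, 1, 2, 3}) ∨ (I = {0, 1} ∨ I = {2, 3}) ∨
        (I = {0, 2} ∨ I = {1, 3}) ∨ (I = {0, 3} ∨ I = {1, 2})) := by
    decide
  rcases hmem I hI with h | h | h | h
  on_goal 1 => use 1
  on_goal 2 => use 2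
  on_goal 3 => use 3
  on_goal 4 => use 4
  all_goals
    rcases h with rfl | rfl <;>
      simp [vI_eq_vecCons, rr_one_vecCons, rr_two_vecCons, rr_three_vecCons,
        rr_four_vecCons] <;> norm_num

theorem exists_foldr_rr_vI_eq {I : Finset (Fin 4)} (hI : Odd I.card) :
    ∃ l : List (Fin 5), l.foldr rr (vI {0}) = vI I := by
  have hmem : ∀ I : Finset (Fin 4), Odd I.card →
      (I = {0} ∨ I = {1} ∨ I = {2} ∨ I = {3} ∨
        I = {1, 2, 3} ∨ I = {0, 2, 3} ∨ I = {0, 1, 3} ∨ I = {0, 1, 2}) := by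
    decide
  rcases hmem I hI with rfl | rfl | rfl | rfl | rfl | rfl | rfl | rfl
  on_goal 1 => use []
  on_goal 2 => use [4, 3]
  on_goal 3 => use [4, 2]
  on_goal 4 => use [3, 2]
  on_goal 5 => use [4, 3, 2, 1]
  on_goal 6 => use [2, 1]
  on_goal 7 => use [3, 1]
  on_goal 8 => use [4, 1]
  all_goals
    simp [vI_eq_vecCons, rr_one_vecCons, rr_two_vecCons, rr_three_vecCons,
      rr_four_vecCons] <;> norm_num

theorem sameOrbit_foldr_rr (l : List (Fin 5)) (a : Fin 4 → ℝ) :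
    SameOrbit a (l.foldr rr a) := by
  induction l with
  | nil => exact .refl a
  | cons i l ih => exact ih.rr i

theorem sameOrbit_vI_of_odd {I : Finset (Fin 4)} (hI : Odd I.card) :
    SameOrbit (vI {0}) (vI I) := by
  obtain ⟨l, hl⟩ := exists_foldr_rr_vI_eq hI
  exact hl ▸ sameOrbit_foldr_rr l _

theorem odd_card_compl {I : Finset (Fin 4)} (hI : Odd I.card) : Odd Iᶜ.card := by
  revert I
  decide

/-- Let `G` be the subgroup of bijections of `ℝ⁴` generated by `r₀,…,r₄`.  For vertices
`v_I, v_J` of the cube `[0,1/2]⁴`: some `g ∈ G` maps `v_I` to `v_J` iff `J = I`, or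
`J = Iᶜ`, or both `|I|` and `|J|` are odd.  (Hence the 16 vertices form exactly 5 orbit
classes.) -/
theorem stmt15 (I J : Finset (Fin 4)) :
    (∃ g ∈ Subgroup.closure genSet, g (vI I) = vI J) ↔
      (J = I ∨ J = Iᶜ ∨ (Odd I.card ∧ Odd J.card)) := by
  change SameOrbit (vI I) (vI J) ↔ _
  constructor
  · intro h
    rcases Nat.even_or_odd I.card with hI | hI
    · exact (h.eq_or_eq_compl hI).imp_right Or.inl
    · rcases Nat.even_or_odd J.card with hJ | hJ
      · rcases h.symm.eq_or_eq_compl hJ with rfl | rfl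
        · exact Or.inl rfl
        · exact Or.inr (Or.inl (compl_compl J).symm)
      · exact Or.inr (Or.inr ⟨hI, hJ⟩)
  · rintro (rfl | rfl | ⟨hI, hJ⟩)
    · exact .refl _
    · rcases Nat.even_or_odd I.card with hI | hI
      · obtain ⟨i, hi⟩ := exists_rr_vI_eq_compl hI
        exact hi ▸ (SameOrbit.refl (vI I)).rr i
      · exact (sameOrbit_vI_of_odd hI).symm.trans (sameOrbit_vI_of_odd (odd_card_compl hI))
    · exact (sameOrbit_vI_of_odd hI).symm.trans (sameOrbit_vI_of_odd hJ)
end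
end

section
/- The composition r₁ ∘ r₂ ∘ r₃ ∘ r₄ equals the point reflection of ℝ⁴ through the point (1/4,1/4,1/4,1/4): for all α ∈ ℝ⁴, (r₁ ∘ r₂ ∘ r₃ ∘ r₄)(α) = (1/2,1/2,1/2,1/2) − α. In particular the map α ↦ (1/2,1/2,1/2,1/2) − α belongs to the group generated by r₀,…,r₄. -/
open Real

noncomputable section

theorem sum_coefVec_mul_self (i : Fin 5) : ∑ t, coefVec i t * coefVec i t = 4 := by
  fin_cases i <;> simp [coefVec, Fin.sum_univ_four] <;> norm_num

theorem rr_toPerm_mem_closure (i : Fin 5) :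
    (rr_involutive i).toPerm ∈ Subgroup.closure genSet :=
  Subgroup.subset_closure ⟨i, rfl⟩

theorem rr_comp_eq_pointReflection (a : Fin 4 → ℝ) :
    (rr 1 ∘ rr 2 ∘ rr 3 ∘ rr 4) a = fun i => 1 / 2 - a i := by
  funext j
  fin_cases j <;> simp [rr, coefVec, coefC, Fin.sum_univ_four] <;> ring

/-- `r₁ ∘ r₂ ∘ r₃ ∘ r₄` is the point reflection through `(1/4,1/4,1/4,1/4)`, i.e. the map
`α ↦ (1/2,1/2,1/2,1/2) − α`; in particular this map belongs to the group generated by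
`r₀,…,r₄`. -/
theorem stmt16 :
    (∀ a : Fin 4 → ℝ, (rr 1 ∘ rr 2 ∘ rr 3 ∘ rr 4) a = fun i => 1 / 2 - a i) ∧
    (∃ g ∈ Subgroup.closure genSet,
      ⇑g = fun (a : Fin 4 → ℝ) (i : Fin 4) => 1 / 2 - a i) := by
  refine ⟨rr_comp_eq_pointReflection, _,
    mul_mem (rr_toPerm_mem_closure 1) (mul_mem (rr_toPerm_mem_closure 2)
      (mul_mem (rr_toPerm_mem_closure 3) (rr_toPerm_mem_closure 4))), ?_⟩
  exact funext rr_comp_eq_pointReflection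
end
end
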